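/- Let n ≥ 2 and let H be the subgroup of T_n consisting of elements fixing the point 0 (a copy of F_n inside T_n). There exist a finite generating set Σ_n of H with n elements and a finite generating set Σ of T_n with n+1 elements such that for every nontrivial ω ∈ H, |ω|_{Σ_n}/(36(n−1)) ≤ |ω|_Σ ≤ 45(n−1)^2·|ω|_{Σ_n} − 1. -/

import Mathlib

noncomputable section

namespace ThompsonPaper

/-- The circle `ℝ/ℤ`. -/
abbrev Circle : Type := AddCircle (1 : ℝ)

/-- Homeomorphisms of a topological space form a group under composition,
with `(f * g) x = f (g x)`. -/
instance homeoGroup {α : Type*} [TopologicalSpace α] : Group (α ≃ₜ α) where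
  mul f g := g.trans f
  one := Homeomorph.refl α
  inv := Homeomorph.symm
  mul_assoc _ _ _ := Homeomorph.ext fun _ => rfl
  one_mul _ := Homeomorph.ext fun _ => rfl
  mul_one _ := Homeomorph.ext fun _ => rfl
  inv_mul_cancel f := Homeomorph.ext fun x => f.symm_apply_apply x

/-- `x` is an `n`-adic rational: `x = a / n ^ k` with `a` an integer, `k` a natural number. -/
def IsNAdic (n : ℕ) (x : ℝ) : Prop := ∃ a : ℤ, ∃ k : ℕ, x = (a : ℝ) / (n : ℝ) ^ k

/-- The set of `n`-adic points of the circle. -/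
def nAdicPoints (n : ℕ) : Set Circle := { p | ∃ x : ℝ, IsNAdic n x ∧ p = (x : Circle) }

/-- `F : ℝ → ℝ` is a lift of the circle map `f`. -/
def IsLift (f : Circle ≃ₜ Circle) (F : ℝ → ℝ) : Prop :=
  ∀ x : ℝ, f (x : Circle) = ((F x : ℝ) : Circle)

/-- `F : ℝ → ℝ` commutes with translation by `1` and is piecewise affine with finitely
many breakpoints (modulo `1`), all breakpoints at `n`-adic rationals, and with the slope
of every affine piece an integer power of `n`. -/
def PiecewiseNAffine (n : ℕ) (F : ℝ → ℝ) : Prop :=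
  (∀ x : ℝ, F (x + 1) = F x + 1) ∧
  ∃ m : ℕ, ∃ t : ℕ → ℝ, ∃ slope : ℕ → ℤ, ∃ c : ℕ → ℝ,
    0 < m ∧ t 0 = 0 ∧ t m = 1 ∧
    (∀ i, i < m → t i < t (i + 1)) ∧
    (∀ i, i ≤ m → IsNAdic n (t i)) ∧
    (∀ i, i < m → ∀ x ∈ Set.Icc (t i) (t (i + 1)),
      F x = (n : ℝ) ^ (slope i) * x + c i)

/-- Membership in Thompson's group `T_n`: an orientation-preserving homeomorphism of the
circle `ℝ/ℤ` mapping the set of `n`-adic points onto itself, which is piecewise affine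
with finitely many breakpoints, all breakpoints at `n`-adic points, and all slopes integer
powers of `n`.  (Orientation preservation and the piecewise affine structure are expressed
through a strictly increasing lift.) -/
def InT (n : ℕ) (f : Circle ≃ₜ Circle) : Prop :=
  f '' nAdicPoints n = nAdicPoints n ∧
  ∃ F : ℝ → ℝ, StrictMono F ∧ IsLift f F ∧ PiecewiseNAffine n F

/-- Thompson's group `T_n`, as a set of circle homeomorphisms. -/
def TnSet (n : ℕ) : Set (Circle ≃ₜ Circle) := { f | InT n f }

/-- Thompson's group `T_n`, as a subgroup of the homeomorphism group of the circle.
(The set `TnSet n` is closed under the group operations, so this subgroup has exactly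
`TnSet n` as its underlying set.) -/
def Tn (n : ℕ) : Subgroup (Circle ≃ₜ Circle) := Subgroup.closure (TnSet n)

/-- The subgroup of `T_n` consisting of the elements fixing the point `0` of the circle
(a copy of `F_n` inside `T_n`). -/
def Fix0 (n : ℕ) : Subgroup (Tn n) where
  carrier := { g | (g : Circle ≃ₜ Circle) ((0 : ℝ) : Circle) = ((0 : ℝ) : Circle) }
  one_mem' := rfl
  mul_mem' := by
    intro a b ha hb
    show (a : Circle ≃ₜ Circle) ((b : Circle ≃ₜ Circle) _) = _
    rw [hb, ha]
  inv_mem' := by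
    intro a ha
    show ((a : Circle ≃ₜ Circle)).symm _ = _
    have h2 := congrArg ((a : Circle ≃ₜ Circle)).symm ha
    rw [Homeomorph.symm_apply_apply] at h2
    exact h2.symm

/-- The word length of `g` with respect to a set `S` of generators: the least `k` such
that `g` is a product of `k` elements of `S ∪ S⁻¹`. -/
def wordLength {G : Type*} [Group G] (S : Set G) (g : G) : ℕ :=
  sInf { k : ℕ | ∃ w : List G, w.length = k ∧ (∀ x ∈ w, x ∈ S ∨ x⁻¹ ∈ S) ∧ w.prod = g }


section phi

variable (n : ℕ) [hn : Fact (2 ≤ n)]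

theorem n_ge : (2:ℝ) ≤ (n:ℝ) := by exact_mod_cast hn.out
theorem n_pos : (0:ℝ) < (n:ℝ) := by linarith [n_ge n]

/-- Coordinate change from the half line to the unit interval. -/
def phi (n : ℕ) (y : ℝ) : ℝ :=
  1 - 1 / (n:ℝ) ^ (⌊y / ((n:ℝ) - 1)⌋₊) +
    (y - (⌊y / ((n:ℝ) - 1)⌋₊ : ℕ) * ((n:ℝ) - 1)) / (n:ℝ) ^ (⌊y / ((n:ℝ) - 1)⌋₊ + 1)

theorem phi_block (q : ℕ) (y : ℝ) (h1 : q * ((n:ℝ) - 1) ≤ y) (h2 : y ≤ (q + 1) * ((n:ℝ) - 1)) :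
    phi n y = 1 - 1 / (n:ℝ) ^ q + (y - q * ((n:ℝ) - 1)) / (n:ℝ) ^ (q + 1) := by
  have h := n_ge n
  have hp : (0:ℝ) < (n:ℝ) - 1 := by linarith
  have hy : 0 ≤ y / ((n:ℝ) - 1) := by
    apply div_nonneg _ hp.le
    refine le_trans ?_ h1
    positivity
  rcases lt_or_eq_of_le h2 with h3 | h3
  · have : ⌊y / ((n:ℝ) - 1)⌋₊ = q := by
      rw [Nat.floor_eq_iff hy]
      exact ⟨by rw [le_div_iff₀ hp]; exact h1, by rw [div_lt_iff₀ hp]; exact h3⟩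
    unfold phi
    rw [this]
  · have : ⌊y / ((n:ℝ) - 1)⌋₊ = q + 1 := by
      rw [Nat.floor_eq_iff hy]
      push_cast
      exact ⟨by rw [le_div_iff₀ hp]; exact h3.ge, by rw [div_lt_iff₀ hp, h3]; nlinarith⟩
    unfold phi
    rw [this, h3]
    have hn0 := n_pos n
    push_cast
    field_simp
    ring

theorem exists_block (y : ℝ) (hy : 0 ≤ y) :
    ∃ q : ℕ, q * ((n:ℝ) - 1) ≤ y ∧ y ≤ (q + 1) * ((n:ℝ) - 1) := by
  have h := n_ge n
  have hp : (0:ℝ) < (n:ℝ) - 1 := by linarith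
  refine ⟨⌊y / ((n:ℝ) - 1)⌋₊, ?_, ?_⟩
  · rw [← le_div_iff₀ hp]; exact Nat.floor_le (by positivity)
  · rw [← div_le_iff₀ hp]; exact (Nat.lt_floor_add_one _).le

theorem phi_shift (y : ℝ) (hy : 0 ≤ y) : phi n (y + ((n:ℝ) - 1)) = 1 - (1 - phi n y) / n := by
  obtain ⟨q, h1, h2⟩ := exists_block n y hy
  have hn0 := n_pos n
  rw [phi_block n q y h1 h2, phi_block n (q + 1) (y + ((n:ℝ) - 1)) (by push_cast; linarith)
    (by push_cast; linarith)]
  push_cast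
  field_simp
  ring

theorem phi_shift_k (k : ℕ) (y : ℝ) (hy : 0 ≤ y) :
    phi n (y + k * ((n:ℝ) - 1)) = 1 - (1 - phi n y) / (n:ℝ) ^ k := by
  have hn0 := n_pos n
  have h := n_ge n
  induction k with
  | zero => simp
  | succ k ih =>
    have : y + ((k + 1 : ℕ):ℝ) * ((n:ℝ) - 1) = (y + k * ((n:ℝ) - 1)) + ((n:ℝ) - 1) := by
      push_cast; ring
    rw [this, phi_shift, ih]
    · field_simp
      ring
    · have : 0 ≤ (k:ℝ) * ((n:ℝ) - 1) := by apply mul_nonneg; positivity; linarith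
      linarith

theorem phi_base (y : ℝ) (h0 : 0 ≤ y) (h1 : y ≤ (n:ℝ) - 1) : phi n y = y / n := by
  rw [phi_block n 0 y (by simpa using h0) (by simpa using h1)]
  simp

theorem phi_mem (y : ℝ) (hy : 0 ≤ y) : 0 ≤ phi n y ∧ phi n y < 1 := by
  obtain ⟨q, h1, h2⟩ := exists_block n y hy
  have hn0 := n_pos n
  have hn2 := n_ge n
  obtain ⟨z, rfl⟩ : ∃ z, y = z + q * ((n:ℝ) - 1) := ⟨y - q * ((n:ℝ) - 1), by ring⟩
  have hz : 0 ≤ z := by linarith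
  have hz1 : z ≤ n - 1 := by linarith
  rw [phi_shift_k n q z hz, phi_base n z hz hz1]
  have h3 : z / n ≤ ((n:ℝ) - 1) / n := by gcongr
  have h5 : ((n:ℝ) - 1) / n < 1 := by rw [div_lt_one hn0]; linarith
  have h6 : (1:ℝ) ≤ (n:ℝ) ^ q := one_le_pow₀ (by linarith)
  have h7 : 0 < (1 - z / n) := by linarith
  have h8 : 0 ≤ z / n := by positivity
  constructor
  · have : (1 - z / n) / (n:ℝ) ^ q ≤ 1 := by rw [div_le_one (by positivity)]; linarith
    linarith
  · have : 0 < (1 - z / n) / (n:ℝ) ^ q := by positivity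
    linarith

theorem phi_lt (x y : ℝ) (hx : 0 ≤ x) (h : x < y) : phi n x < phi n y := by
  obtain ⟨q, h1, h2⟩ := exists_block n x hx
  have hn0 := n_pos n
  have hn2 := n_ge n
  obtain ⟨z, rfl⟩ : ∃ z, x = z + q * ((n:ℝ) - 1) := ⟨x - q * ((n:ℝ) - 1), by ring⟩
  obtain ⟨w, rfl⟩ : ∃ w, y = w + q * ((n:ℝ) - 1) := ⟨y - q * ((n:ℝ) - 1), by ring⟩
  have hz : 0 ≤ z := by linarith
  have hz1 : z ≤ n - 1 := by linarith
  have hzw : z < w := by linarith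
  rw [phi_shift_k n q z hz, phi_shift_k n q w (by linarith)]
  suffices phi n z < phi n w by
    have : (1 - phi n w) / (n:ℝ) ^ q < (1 - phi n z) / (n:ℝ) ^ q := by gcongr
    linarith
  rw [phi_base n z hz hz1]
  rcases le_total w (n - 1) with h3 | h3
  · rw [phi_base n w (by linarith) h3]; gcongr
  · rcases eq_or_lt_of_le h3 with h4 | h4
    · rw [phi_base n w (by linarith) h4.ge]; gcongr
    · obtain ⟨v, rfl⟩ : ∃ v, w = v + ((n:ℝ) - 1) := ⟨w - ((n:ℝ) - 1), by ring⟩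
      rw [phi_shift n v (by linarith)]
      have h5 : phi n 0 < phi n v ∨ True := Or.inr trivial
      have hv : 0 < v := by linarith
      obtain ⟨h6, h7⟩ := phi_mem n v hv.le
      have h8 : z / n ≤ ((n:ℝ) - 1) / n := by gcongr
      have h9 : ((n:ℝ) - 1) / n = 1 - 1 / n := by field_simp
      have h10 : 0 < phi n v := by
        obtain ⟨q', g1, g2⟩ := exists_block n v hv.le
        rcases Nat.eq_zero_or_pos q' with rfl | hq
        · rw [phi_base n v hv.le (by simpa using g2)]; positivity
        · obtain ⟨p, rfl⟩ := Nat.exists_eq_succ_of_ne_zero hq.ne'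
          have g3 : ((n:ℝ) - 1) ≤ v := by
            push_cast at g1
            nlinarith [mul_nonneg (Nat.cast_nonneg (α := ℝ) p) (by linarith : (0:ℝ) ≤ (n:ℝ) - 1)]
          obtain ⟨v', rfl⟩ : ∃ v', v = v' + ((n:ℝ) - 1) := ⟨v - ((n:ℝ) - 1), by ring⟩
          rw [phi_shift n v' (by linarith)]
          obtain ⟨k6, k7⟩ := phi_mem n v' (by linarith)
          have : (1 - phi n v') / n < 1 := by rw [div_lt_one hn0]; linarith
          linarith
      have : (1 - phi n v) / n < 1 / n := by gcongr; linarith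
      linarith

theorem phi_zero : phi n 0 = 0 := by
  have hn2 := n_ge n
  rw [phi_base n 0 le_rfl (by linarith)]; simp

theorem phi_le (x y : ℝ) (hx : 0 ≤ x) (h : x ≤ y) : phi n x ≤ phi n y := by
  rcases eq_or_lt_of_le h with rfl | h
  · exact le_rfl
  · exact (phi_lt n x y hx h).le

theorem phi_inj (x y : ℝ) (hx : 0 ≤ x) (hy : 0 ≤ y) (h : phi n x = phi n y) : x = y := by
  rcases lt_trichotomy x y with h1 | h1 | h1
  · exact absurd h (phi_lt n x y hx h1).ne
  · exact h1
  · exact absurd h (phi_lt n y x hy h1).ne'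

theorem phi_surj_aux (k : ℕ) : ∀ z : ℝ, 0 ≤ z → z < 1 - 1 / (n:ℝ) ^ k → ∃ y, 0 ≤ y ∧ phi n y = z := by
  have hn0 := n_pos n
  have hn2 := n_ge n
  induction k with
  | zero => intro z h0 h1; simp at h1; linarith
  | succ k ih =>
    intro z h0 h1
    rcases le_total z (1 - 1 / n) with h | h
    · refine ⟨n * z, by positivity, ?_⟩
      rw [phi_base n _ (by positivity)]
      · field_simp
      · have : (n:ℝ) * z ≤ n * (1 - 1 / n) := by gcongr
        have h2 : (n:ℝ) * (1 - 1 / n) = n - 1 := by field_simp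
        linarith
    · obtain ⟨y, hy, hy2⟩ := ih (1 - n * (1 - z)) (by
          have : (n:ℝ) * (1 - z) ≤ n * (1 / n) := by gcongr; linarith
          have h2 : (n:ℝ) * (1 / n) = 1 := by field_simp
          linarith) (by
          have : (n:ℝ) * (1 / (n:ℝ) ^ (k + 1)) < n * (1 - z) := by gcongr; linarith
          have h2 : (n:ℝ) * (1 / (n:ℝ) ^ (k + 1)) = 1 / (n:ℝ) ^ k := by field_simp; ring
          linarith)
      refine ⟨y + ((n:ℝ) - 1), by linarith, ?_⟩
      rw [phi_shift n y hy, hy2]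
      field_simp
      ring

theorem phi_surj (z : ℝ) (h0 : 0 ≤ z) (h1 : z < 1) : ∃ y, 0 ≤ y ∧ phi n y = z := by
  have hn0 := n_pos n
  have hn2 := n_ge n
  obtain ⟨k, hk⟩ := exists_pow_lt_of_lt_one (by linarith : 0 < 1 - z)
    (by rw [div_lt_one hn0]; linarith : 1 / (n:ℝ) < 1)
  refine phi_surj_aux n k z h0 ?_
  rw [one_div_pow] at hk
  linarith

/-- The coordinate map to the circle. -/
def psi (n : ℕ) (y : ℝ) : Circle := ((phi n y : ℝ) : Circle)

theorem coe_inj (x y : ℝ) (hx : 0 ≤ x) (hx1 : x < 1) (hy : 0 ≤ y) (hy1 : y < 1)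
    (h : (x : Circle) = (y : Circle)) : x = y := by
  have : Fact ((0:ℝ) < 1) := ⟨one_pos⟩
  have := (AddCircle.coe_eq_coe_iff_of_mem_Ico (p := (1:ℝ)) (a := 0) (x := x) (y := y)
    ⟨hx, by linarith⟩ ⟨hy, by linarith⟩).1 h
  exact this

theorem coe_one' : ((1:ℝ) : Circle) = ((0:ℝ) : Circle) := by
  rw [AddCircle.coe_period]; simp

theorem exists_coe (p : Circle) : ∃ x : ℝ, 0 ≤ x ∧ x < 1 ∧ p = (x : Circle) := by
  have : Fact ((0:ℝ) < 1) := ⟨one_pos⟩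
  have := AddCircle.coe_image_Ico_eq (1:ℝ) 0
  have h : p ∈ ((↑) : ℝ → Circle) '' Set.Ico 0 (0 + 1) := by rw [this]; trivial
  obtain ⟨x, hx, rfl⟩ := h
  exact ⟨x, hx.1, by simpa using hx.2, rfl⟩

theorem psi_inj (x y : ℝ) (hx : 0 ≤ x) (hy : 0 ≤ y) (h : psi n x = psi n y) : x = y :=
  phi_inj n x y hx hy (coe_inj _ _ (phi_mem n x hx).1 (phi_mem n x hx).2
    (phi_mem n y hy).1 (phi_mem n y hy).2 h)

theorem psi_surj (p : Circle) : ∃ y, 0 ≤ y ∧ psi n y = p := by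
  obtain ⟨x, h0, h1, rfl⟩ := exists_coe p
  obtain ⟨y, hy, h⟩ := phi_surj n x h0 h1
  exact ⟨y, hy, by rw [psi, h]⟩

theorem psi_zero : psi n 0 = ((0:ℝ) : Circle) := by rw [psi, phi_zero]

end phi

set_option linter.unusedSectionVars false
section gens

/-- The piecewise affine model map. -/
def Ff (n : ℕ) (u d x : ℝ) : ℝ :=
  max x (min (n * (x - u) + u) (min (x + d) (1 - (1 - x) / n)))

/-- Its inverse. -/
def Gf (n : ℕ) (u d y : ℝ) : ℝ :=
  min y (max ((y - u) / n + u) (max (y - d) (1 - n * (1 - y))))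

variable (n : ℕ) [hn : Fact (2 ≤ n)]

theorem F_le_iff (u d x y : ℝ) : Ff n u d x ≤ y ↔ x ≤ Gf n u d y := by
  have hn0 := n_pos n
  unfold Ff Gf
  simp only [max_le_iff, min_le_iff, le_min_iff, le_max_iff]
  have h1 : n * (x - u) + u ≤ y ↔ x ≤ (y - u) / n + u := by
    rw [← sub_le_iff_le_add (a := x), le_div_iff₀ hn0]
    constructor <;> intro h <;> linarith
  have h2 : x + d ≤ y ↔ x ≤ y - d := by constructor <;> intro h <;> linarith
  have h3 : 1 - (1 - x) / n ≤ y ↔ x ≤ 1 - n * (1 - y) := by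
    rw [sub_le_comm, le_div_iff₀ hn0]
    constructor <;> intro h <;> linarith
  rw [h1, h2, h3]

theorem le_F_iff (u d x y : ℝ) : y ≤ Ff n u d x ↔ Gf n u d y ≤ x := by
  have hn0 := n_pos n
  unfold Ff Gf
  simp only [max_le_iff, min_le_iff, le_min_iff, le_max_iff]
  have h1 : y ≤ n * (x - u) + u ↔ (y - u) / n + u ≤ x := by
    rw [← le_sub_iff_add_le, div_le_iff₀ hn0]
    constructor <;> intro h <;> linarith
  have h2 : y ≤ x + d ↔ y - d ≤ x := by constructor <;> intro h <;> linarith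
  have h3 : y ≤ 1 - (1 - x) / n ↔ 1 - n * (1 - y) ≤ x := by
    rw [le_sub_comm, div_le_iff₀ hn0]
    constructor <;> intro h <;> linarith
  rw [h1, h2, h3]

theorem G_F (u d x : ℝ) : Gf n u d (Ff n u d x) = x :=
  le_antisymm ((le_F_iff n u d x _).1 le_rfl) ((F_le_iff n u d x _).1 le_rfl)

theorem F_G (u d x : ℝ) : Ff n u d (Gf n u d x) = x :=
  le_antisymm ((F_le_iff n u d _ _).2 le_rfl) ((le_F_iff n u d _ _).2 le_rfl)

theorem F_strictMono (u d : ℝ) : StrictMono (Ff n u d) := by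
  intro x y h
  by_contra hc
  have := (F_le_iff n u d _ _).1 (not_lt.1 hc)
  rw [G_F] at this
  linarith

theorem F_zero (u d : ℝ) (hu : 0 ≤ u) : Ff n u d 0 = 0 := by
  have h := n_ge n
  unfold Ff
  apply max_eq_left
  apply min_le_of_left_le
  nlinarith

theorem F_one (u d : ℝ) : Ff n u d 1 = 1 := by
  unfold Ff
  apply max_eq_left
  apply min_le_of_right_le
  apply min_le_of_right_le
  simp

theorem G_zero (u d : ℝ) (hu : 0 ≤ u) : Gf n u d 0 = 0 := by
  conv_lhs => rw [← F_zero n u d hu]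
  exact G_F n u d 0

theorem G_one (u d : ℝ) : Gf n u d 1 = 1 := by
  conv_lhs => rw [← F_one n u d]
  exact G_F n u d 1

theorem F_cont (u d : ℝ) : Continuous (Ff n u d) := by unfold Ff; fun_prop

theorem G_cont (u d : ℝ) : Continuous (Gf n u d) := by unfold Gf; fun_prop

theorem F_mem (u d : ℝ) (hu : 0 ≤ u) (x : ℝ) (h0 : 0 ≤ x) (h1 : x < 1) :
    0 ≤ Ff n u d x ∧ Ff n u d x < 1 := by
  constructor
  · have := (F_strictMono n u d).monotone h0
    rwa [F_zero n u d hu] at this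
  · have := (F_strictMono n u d) h1
    rwa [F_one] at this

theorem G_mem (u d : ℝ) (hu : 0 ≤ u) (x : ℝ) (h0 : 0 ≤ x) (h1 : x < 1) :
    0 ≤ Gf n u d x ∧ Gf n u d x < 1 := by
  constructor
  · rw [← F_le_iff, F_zero n u d hu]; exact h0
  · by_contra hc
    rw [not_lt, ← F_le_iff, F_one] at hc
    linarith

instance factOne : Fact ((0:ℝ) < 1) := ⟨one_pos⟩

theorem liftIco_apply (f : ℝ → Circle) (x : ℝ) (h0 : 0 ≤ x) (h1 : x < 1) :
    AddCircle.liftIco (1:ℝ) 0 f (x : Circle) = f x :=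
  AddCircle.liftIco_coe_apply ⟨h0, by simpa using h1⟩

/-- The circle homeomorphism defined by the model map. -/
def circHomeo (u d : ℝ) (hu : 0 ≤ u) : Circle ≃ₜ Circle where
  toFun := AddCircle.liftIco (1:ℝ) 0 (fun x => ((Ff n u d x : ℝ) : Circle))
  invFun := AddCircle.liftIco (1:ℝ) 0 (fun x => ((Gf n u d x : ℝ) : Circle))
  left_inv p := by
    obtain ⟨x, h0, h1, rfl⟩ := exists_coe p
    obtain ⟨g0, g1⟩ := F_mem n u d hu x h0 h1
    rw [liftIco_apply _ x h0 h1, liftIco_apply _ _ g0 g1, G_F]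
  right_inv p := by
    obtain ⟨x, h0, h1, rfl⟩ := exists_coe p
    obtain ⟨g0, g1⟩ := G_mem n u d hu x h0 h1
    rw [liftIco_apply _ x h0 h1, liftIco_apply _ _ g0 g1, F_G]
  continuous_toFun := by
    apply AddCircle.liftIco_continuous
    · rw [zero_add, F_zero n u d hu, F_one, coe_one']
    · exact ((AddCircle.continuous_mk' 1).comp (F_cont n u d)).continuousOn
  continuous_invFun := by
    apply AddCircle.liftIco_continuous
    · rw [zero_add, G_zero n u d hu, G_one, coe_one']
    · exact ((AddCircle.continuous_mk' 1).comp (G_cont n u d)).continuousOn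

theorem circHomeo_apply (u d : ℝ) (hu : 0 ≤ u) (x : ℝ) (h0 : 0 ≤ x) (h1 : x < 1) :
    circHomeo n u d hu (x : Circle) = ((Ff n u d x : ℝ) : Circle) :=
  liftIco_apply (fun x => ((Ff n u d x : ℝ) : Circle)) x h0 h1

theorem circHomeo_symm_apply (u d : ℝ) (hu : 0 ≤ u) (x : ℝ) (h0 : 0 ≤ x) (h1 : x < 1) :
    (circHomeo n u d hu).symm (x : Circle) = ((Gf n u d x : ℝ) : Circle) :=
  liftIco_apply (fun x => ((Gf n u d x : ℝ) : Circle)) x h0 h1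

theorem coe_add_int (x : ℝ) (z : ℤ) : ((x + z : ℝ) : Circle) = (x : Circle) := by
  have h : ((z : ℝ) : Circle) = 0 := by
    rw [AddCircle.coe_eq_zero_iff]
    exact ⟨z, by simp⟩
  rw [AddCircle.coe_add, h, add_zero]

theorem coe_fract (x : ℝ) : ((Int.fract x : ℝ) : Circle) = (x : Circle) := by
  conv_rhs => rw [← Int.fract_add_floor x]
  rw [coe_add_int]

/-- The lift of the circle map. -/
def Fl (n : ℕ) (u d x : ℝ) : ℝ := Ff n u d (Int.fract x) + (⌊x⌋ : ℤ)

theorem Fl_isLift (u d : ℝ) (hu : 0 ≤ u) : IsLift (circHomeo n u d hu) (Fl n u d) := by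
  intro x
  rw [← coe_fract x, circHomeo_apply n u d hu _ (Int.fract_nonneg x) (Int.fract_lt_one x), Fl,
    coe_add_int]

theorem Fl_strictMono (u d : ℝ) (hu : 0 ≤ u) : StrictMono (Fl n u d) := by
  intro x y h
  unfold Fl
  rcases eq_or_lt_of_le (Int.floor_mono h.le) with h1 | h1
  · rw [h1]
    have : Int.fract x < Int.fract y := by
      unfold Int.fract; rw [h1]; linarith
    linarith [F_strictMono n u d this]
  · have h2 := F_mem n u d hu _ (Int.fract_nonneg x) (Int.fract_lt_one x)
    have h3 := F_mem n u d hu _ (Int.fract_nonneg y) (Int.fract_lt_one y)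
    have h4 : ((⌊x⌋ : ℤ):ℝ) + 1 ≤ (⌊y⌋ : ℤ) := by exact_mod_cast h1
    linarith [h2.2, h3.1]

theorem Fl_eq (u d : ℝ) (hu : 0 ≤ u) (x : ℝ) (h0 : 0 ≤ x) (h1 : x ≤ 1) : Fl n u d x = Ff n u d x := by
  rcases eq_or_lt_of_le h1 with rfl | h1
  · unfold Fl; simp [F_one, F_zero n u d hu]
  · unfold Fl
    rw [Int.fract_eq_self.2 ⟨h0, h1⟩, Int.floor_eq_zero_iff.2 ⟨h0, h1⟩]
    simp

end gens

set_option linter.unusedSectionVars false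
section gens2
variable (n : ℕ) [hn : Fact (2 ≤ n)]

theorem Ff_1 (u d x : ℝ) (h : x ≤ u) : Ff n u d x = x := by
  have hn2 := n_ge n
  unfold Ff
  apply max_eq_left
  apply min_le_of_left_le
  nlinarith

theorem Ff_2 (v r u d x : ℝ) (hv : 0 < v) (hr : 0 ≤ r) (hr1 : r + 2 ≤ n)
    (hu : u = 1 - (n - r) * n * v) (hd : d = (n - 1) * (n - 1 - r) * v)
    (h : u ≤ x) (h1 : x ≤ u + (n - 1 - r) * v) : Ff n u d x = n * (x - u) + u := by
  have hn2 := n_ge n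
  have hn0 := n_pos n
  obtain ⟨s, rfl⟩ : ∃ s, x = u + s := ⟨x - u, by ring⟩
  have hs : 0 ≤ s := by linarith
  have hs1 : s ≤ (n - 1 - r) * v := by linarith
  unfold Ff
  have e1 : (n - 1) * s ≤ (n - 1) * ((n - 1 - r) * v) := by gcongr; linarith
  rw [min_eq_left, max_eq_right]
  · nlinarith
  · apply le_min
    · rw [hd]; linarith
    · rw [le_sub_comm, div_le_iff₀ hn0, hu]
      have e2 : (n + 1) * s ≤ (n + 1) * ((n - 1 - r) * v) := by gcongr
      have e3 : (n + 1) * s ≤ n * v * (n - r) := by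
        have : 0 ≤ (1 + r) * v := by positivity
        nlinarith
      have e4 : (n - 1) * ((n + 1) * s) ≤ (n - 1) * (n * v * (n - r)) := by gcongr; linarith
      linarith

theorem Ff_3 (v r u d x : ℝ) (hv : 0 < v) (hr : 0 ≤ r) (hr1 : r + 2 ≤ n)
    (hu : u = 1 - (n - r) * n * v) (hd : d = (n - 1) * (n - 1 - r) * v)
    (h : u + (n - 1 - r) * v ≤ x) (h1 : x ≤ u + n * v) : Ff n u d x = x + d := by
  have hn2 := n_ge n
  have hn0 := n_pos n
  obtain ⟨s, rfl⟩ : ∃ s, x = u + s := ⟨x - u, by ring⟩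
  have hs : (n - 1 - r) * v ≤ s := by linarith
  have hs1 : s ≤ n * v := by linarith
  unfold Ff
  have e1 : (n - 1) * ((n - 1 - r) * v) ≤ (n - 1) * s := by gcongr; linarith
  have hd0 : 0 ≤ d := by
    rw [hd]; apply mul_nonneg _ hv.le; apply mul_nonneg <;> linarith
  rw [min_eq_right, min_eq_left, max_eq_right]
  · linarith
  · rw [le_sub_comm, div_le_iff₀ hn0, hu, hd]
    have e4 : (n - 1) * s ≤ (n - 1) * (n * v) := by gcongr; linarith
    linarith
  · apply min_le_of_left_le
    rw [hd]; linarith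

theorem Ff_4 (v r u d x : ℝ) (hv : 0 < v) (hr : 0 ≤ r) (hr1 : r + 2 ≤ n)
    (hu : u = 1 - (n - r) * n * v) (hd : d = (n - 1) * (n - 1 - r) * v)
    (h : u + n * v ≤ x) (h1 : x ≤ 1) : Ff n u d x = 1 - (1 - x) / n := by
  have hn2 := n_ge n
  have hn0 := n_pos n
  obtain ⟨s, rfl⟩ : ∃ s, x = 1 - n * s := ⟨(1 - x) / n, by field_simp; ring⟩
  have hs0 : 0 ≤ s := by
    by_contra hc
    nlinarith
  have hs : s ≤ (n - r - 1) * v := by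
    rw [hu] at h
    have : n * s ≤ n * ((n - r - 1) * v) := by linarith
    exact le_of_mul_le_mul_left this hn0
  have hh : (1 - (1 - n * s)) / n = s := by field_simp; ring
  unfold Ff
  rw [hh]
  have e1 : (n - 1) * s ≤ (n - 1) * ((n - r - 1) * v) := by gcongr; linarith
  rw [min_eq_right, min_eq_right, max_eq_right]
  · nlinarith
  · rw [hd]; linarith
  · apply min_le_of_right_le
    rw [hu]
    have e4 : (n + 1) * ((n - 1) * s) ≤ (n + 1) * ((n - 1) * ((n - r - 1) * v)) := by gcongr
    have e5 : 0 ≤ (n - 1) * v * (1 + r) := by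
      apply mul_nonneg (mul_nonneg _ hv.le) <;> linarith
    nlinarith

/-- The scale. -/
def vn (n i : ℕ) : ℝ := 1 / (n:ℝ) ^ (i / (n - 1) + 2)

/-- The translation part. -/
def dn (n i : ℕ) : ℝ := (n - 1) * (n - 1 - (i % (n - 1) : ℕ)) * vn n i

theorem dn_eq (i : ℕ) : dn n i = (n - 1) * (n - 1 - (i % (n - 1) : ℕ)) * vn n i := rfl

theorem cast_sub_one : ((n - 1 : ℕ) : ℝ) = (n:ℝ) - 1 := by
  have := hn.out
  push_cast [Nat.cast_sub (by omega : 1 ≤ n)]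
  rfl

theorem i_eq (i : ℕ) : (i:ℝ) = (i / (n - 1) : ℕ) * ((n:ℝ) - 1) + (i % (n - 1) : ℕ) := by
  rw [← cast_sub_one]
  exact_mod_cast (Nat.div_add_mod' i (n - 1)).symm

theorem r_le (i : ℕ) : ((i % (n - 1) : ℕ) : ℝ) + 2 ≤ n := by
  have := hn.out
  have h : i % (n - 1) < n - 1 := Nat.mod_lt _ (by omega)
  exact_mod_cast (by omega : i % (n - 1) + 2 ≤ n)

theorem vn_pos (i : ℕ) : 0 < vn n i := by
  have hn0 := n_pos n
  unfold vn; positivity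

theorem phi_i (i : ℕ) : phi n i = 1 - (n - (i % (n - 1) : ℕ)) * n * vn n i := by
  have hn0 := n_pos n
  have h := i_eq n i
  have h2 := r_le n i
  rw [phi_block n (i / (n - 1)) i]
  · unfold vn
    generalize i / (n - 1) = q at *
    generalize i % (n - 1) = r at *
    rw [h]
    field_simp
    ring
  · rw [h]; simp
  · rw [h]; linarith

theorem phi_i_add (i : ℕ) (s : ℝ) (h0 : 0 ≤ s) (h1 : s ≤ n - 1 - (i % (n - 1) : ℕ)) :
    phi n (i + s) = phi n i + s * (n * vn n i) := by
  have hn0 := n_pos n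
  have h := i_eq n i
  have h2 := r_le n i
  have h3 : (0:ℝ) ≤ (i % (n - 1) : ℕ) := by positivity
  rw [phi_i, phi_block n (i / (n - 1)) (i + s)]
  · unfold vn
    generalize i / (n - 1) = q at *
    generalize i % (n - 1) = r at *
    rw [h]
    field_simp
    ring
  · rw [h]; linarith
  · rw [h]; linarith

theorem phi_i_add2 (i : ℕ) (s : ℝ) (h0 : n - 1 - (i % (n - 1) : ℕ) ≤ s) (h1 : s ≤ n) :
    phi n (i + s) = phi n i + dn n i + s * vn n i := by
  have hn0 := n_pos n
  have h := i_eq n i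
  have h2 := r_le n i
  have h3 : (0:ℝ) ≤ (i % (n - 1) : ℕ) := by positivity
  rw [phi_i, phi_block n (i / (n - 1) + 1) (i + s)]
  · unfold dn vn
    generalize i / (n - 1) = q at *
    generalize i % (n - 1) = r at *
    rw [h]
    push_cast
    field_simp
    ring
  · rw [h]; push_cast; linarith
  · rw [h]; push_cast; linarith

/-- The generators `X_i`. -/
def X (i : ℕ) : Circle ≃ₜ Circle := circHomeo n (phi n i) (dn n i) (phi_mem n i (Nat.cast_nonneg i)).1

theorem X_psi (i : ℕ) (y : ℝ) (h0 : 0 ≤ y) :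
    X n i (psi n y) = ((Ff n (phi n i) (dn n i) (phi n y) : ℝ) : Circle) :=
  circHomeo_apply n _ _ _ _ (phi_mem n y h0).1 (phi_mem n y h0).2

theorem X_1 (i : ℕ) (y : ℝ) (h0 : 0 ≤ y) (h1 : y ≤ i) : X n i (psi n y) = psi n y := by
  rw [X_psi n i y h0, Ff_1 n _ _ _ (phi_le n y i h0 h1)]; rfl

theorem X_2 (i : ℕ) (s : ℝ) (h0 : 0 ≤ s) (h1 : s ≤ 1) :
    X n i (psi n (i + s)) = psi n (i + n * s) := by
  have hn0 := n_pos n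
  have hv := vn_pos n i
  have hr := r_le n i
  have hr0 : (0:ℝ) ≤ (i % (n - 1) : ℕ) := by positivity
  have e : phi n (i + s) = phi n i + s * (n * vn n i) := phi_i_add n i s h0 (by linarith)
  rw [X_psi n i _ (by positivity)]
  rcases le_total (n * s) (n - 1 - (i % (n - 1) : ℕ)) with h | h
  · rw [Ff_2 n (vn n i) (i % (n - 1) : ℕ) _ _ _ hv hr0 hr (phi_i n i) (dn_eq n i), psi,
      phi_i_add n i (n * s) (by positivity) h, e]
    · congr 1; ring
    · rw [e]; have : 0 ≤ s * (n * vn n i) := by positivity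
      linarith
    · rw [e]
      have : n * s * vn n i ≤ (n - 1 - (i % (n - 1) : ℕ)) * vn n i := by gcongr
      linarith
  · rw [Ff_3 n (vn n i) (i % (n - 1) : ℕ) _ _ _ hv hr0 hr (phi_i n i) (dn_eq n i), psi,
      phi_i_add2 n i (n * s) h (by nlinarith), e]
    · congr 1; ring
    · rw [e]
      have : (n - 1 - (i % (n - 1) : ℕ)) * vn n i ≤ n * s * vn n i := by gcongr
      linarith
    · rw [e]
      have : s * (n * vn n i) ≤ 1 * (n * vn n i) := by gcongr
      linarith

theorem X_3 (i : ℕ) (y : ℝ) (h0 : (i:ℝ) + 1 ≤ y) :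
    X n i (psi n y) = psi n (y + ((n:ℝ) - 1)) := by
  have hi : (0:ℝ) ≤ i := by positivity
  have hr := r_le n i
  have hr0 : (0:ℝ) ≤ (i % (n - 1) : ℕ) := by positivity
  have hy : 0 ≤ y := by linarith
  rw [X_psi n i y hy, Ff_4 n (vn n i) (i % (n - 1) : ℕ) _ _ _ (vn_pos n i) hr0 hr (phi_i n i) (dn_eq n i),
    psi, phi_shift n y hy]
  · have := phi_le n (i + 1) y (by positivity) h0
    rw [phi_i_add n i 1 zero_le_one (by linarith)] at this
    linarith
  · exact (phi_mem n y hy).2.le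

end gens2

set_option linter.unusedSectionVars false
section inT
variable (n : ℕ) [hn : Fact (2 ≤ n)]

theorem nadic_add (x y : ℝ) (hx : IsNAdic n x) (hy : IsNAdic n y) : IsNAdic n (x + y) := by
  have hn0 := n_pos n
  obtain ⟨a, k, rfl⟩ := hx
  obtain ⟨b, l, rfl⟩ := hy
  refine ⟨a * n ^ l + b * n ^ k, k + l, ?_⟩
  push_cast
  field_simp
  ring

theorem nadic_int (a : ℤ) : IsNAdic n a := ⟨a, 0, by simp⟩

theorem nadic_mul (x y : ℝ) (hx : IsNAdic n x) (hy : IsNAdic n y) : IsNAdic n (x * y) := by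
  have hn0 := n_pos n
  obtain ⟨a, k, rfl⟩ := hx
  obtain ⟨b, l, rfl⟩ := hy
  refine ⟨a * b, k + l, ?_⟩
  push_cast
  field_simp
  ring

theorem nadic_sub (x y : ℝ) (hx : IsNAdic n x) (hy : IsNAdic n y) : IsNAdic n (x - y) := by
  have : x - y = x + (-1 : ℤ) * y := by push_cast; ring
  rw [this]
  exact nadic_add n _ _ hx (nadic_mul n _ _ (nadic_int n _) hy)

theorem nadic_nat (a : ℕ) : IsNAdic n a := by simpa using nadic_int n a

theorem nadic_one : IsNAdic n 1 := by simpa using nadic_nat n 1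

theorem nadic_div (x : ℝ) (hx : IsNAdic n x) : IsNAdic n (x / n) := by
  have hn0 := n_pos n
  obtain ⟨a, k, rfl⟩ := hx
  exact ⟨a, k + 1, by field_simp; ring⟩

theorem nadic_inv_pow (k : ℕ) : IsNAdic n (1 / (n:ℝ) ^ k) := ⟨1, k, by simp⟩

theorem nadic_max (x y : ℝ) (hx : IsNAdic n x) (hy : IsNAdic n y) : IsNAdic n (max x y) := by
  rcases max_choice x y with h | h <;> rw [h] <;> assumption

theorem nadic_min (x y : ℝ) (hx : IsNAdic n x) (hy : IsNAdic n y) : IsNAdic n (min x y) := by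
  rcases min_choice x y with h | h <;> rw [h] <;> assumption

theorem nadic_Ff (u d x : ℝ) (hu : IsNAdic n u) (hd : IsNAdic n d) (hx : IsNAdic n x) :
    IsNAdic n (Ff n u d x) := by
  unfold Ff
  have h1 := nadic_one n
  refine nadic_max n _ _ hx (nadic_min n _ _ ?_ (nadic_min n _ _ (nadic_add n _ _ hx hd) ?_))
  · exact nadic_add n _ _ (nadic_mul n _ _ (nadic_nat n n) (nadic_sub n _ _ hx hu)) hu
  · exact nadic_sub n _ _ h1 (nadic_div n _ (nadic_sub n _ _ h1 hx))

theorem nadic_Gf (u d x : ℝ) (hu : IsNAdic n u) (hd : IsNAdic n d) (hx : IsNAdic n x) :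
    IsNAdic n (Gf n u d x) := by
  unfold Gf
  have h1 := nadic_one n
  refine nadic_min n _ _ hx (nadic_max n _ _ ?_ (nadic_max n _ _ (nadic_sub n _ _ hx hd) ?_))
  · exact nadic_add n _ _ (nadic_div n _ (nadic_sub n _ _ hx hu)) hu
  · exact nadic_sub n _ _ h1 (nadic_mul n _ _ (nadic_nat n n) (nadic_sub n _ _ h1 hx))

theorem nadic_vn (i : ℕ) : IsNAdic n (vn n i) := nadic_inv_pow n _

theorem nadic_phi_i (i : ℕ) : IsNAdic n (phi n i) := by
  rw [phi_i]
  exact nadic_sub n _ _ (nadic_one n) (nadic_mul n _ _ (nadic_mul n _ _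
    (nadic_sub n _ _ (nadic_nat n _) (nadic_nat n _)) (nadic_nat n _)) (nadic_vn n i))

theorem nadic_dn (i : ℕ) : IsNAdic n (dn n i) := by
  have h := nadic_sub n _ _ (nadic_nat n n) (nadic_one n)
  exact nadic_mul n _ _ (nadic_mul n _ _ h (nadic_sub n _ _ h (nadic_nat n _))) (nadic_vn n i)

theorem nadic_fract (x : ℝ) (hx : IsNAdic n x) : IsNAdic n (Int.fract x) :=
  nadic_sub n _ _ hx (nadic_int n _)

theorem circ_nadic (u d : ℝ) (h0 : 0 ≤ u) (hu : IsNAdic n u) (hd : IsNAdic n d) :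
    circHomeo n u d h0 '' nAdicPoints n = nAdicPoints n := by
  apply Set.Subset.antisymm
  · rintro _ ⟨_, ⟨x, hx, rfl⟩, rfl⟩
    refine ⟨Ff n u d (Int.fract x), nadic_Ff n u d _ hu hd (nadic_fract n x hx), ?_⟩
    rw [← coe_fract, circHomeo_apply n u d h0 _ (Int.fract_nonneg x) (Int.fract_lt_one x)]
  · rintro _ ⟨x, hx, rfl⟩
    refine ⟨(circHomeo n u d h0).symm x, ?_, by simp⟩
    refine ⟨Gf n u d (Int.fract x), nadic_Gf n u d _ hu hd (nadic_fract n x hx), ?_⟩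
    rw [← coe_fract, circHomeo_symm_apply n u d h0 _ (Int.fract_nonneg x) (Int.fract_lt_one x)]

theorem X_piece (i : ℕ) (a : ℕ) (ha : a < n ^ (i / (n - 1) + 2)) : ∃ s : ℤ, ∃ c : ℝ,
    ∀ x ∈ Set.Icc ((a:ℝ) * vn n i) (((a:ℝ) + 1) * vn n i),
      Fl n (phi n i) (dn n i) x = (n:ℝ) ^ s * x + c := by
  have hn0 := n_pos n
  have hv := vn_pos n i
  have hr := r_le n i
  have hr0 : (0:ℝ) ≤ (i % (n - 1) : ℕ) := by positivity
  set N : ℕ := n ^ (i / (n - 1) + 2) with hN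
  have hNv : (N:ℝ) * vn n i = 1 := by
    rw [hN]; unfold vn; push_cast; field_simp
  set u := phi n i with hu
  have hui : u = 1 - (n - (i % (n - 1) : ℕ)) * n * vn n i := phi_i n i
  set r := i % (n - 1) with hr_def
  set v := vn n i with hv_def
  set A : ℤ := N - (n - r) * n with hA
  have hAu : (A:ℝ) * v = u := by
    rw [hA, hui]; push_cast; linear_combination hNv
  have key : ∀ x ∈ Set.Icc ((a:ℝ) * v) (((a:ℝ) + 1) * v), Fl n u (dn n i) x = Ff n u (dn n i) x ∧ x ≤ 1 := by
    intro x hx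
    have h1 : x ≤ 1 := by
      refine hx.2.trans ?_
      have : ((a:ℝ) + 1) * v ≤ N * v := mul_le_mul_of_nonneg_right (by exact_mod_cast ha) hv.le
      linarith
    exact ⟨Fl_eq n u _ (phi_mem n i (Nat.cast_nonneg i)).1 x (le_trans (by positivity) hx.1) h1, h1⟩
  rcases le_or_gt ((a:ℤ) + 1) A with h | h
  · refine ⟨0, 0, fun x hx => ?_⟩
    rw [(key x hx).1, Ff_1]
    · simp
    · refine hx.2.trans ?_
      rw [← hAu]; gcongr; exact_mod_cast h
  have g1 : u ≤ a * v := by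
    rw [← hAu]; gcongr; exact_mod_cast (by omega : A ≤ a)
  rcases le_or_gt ((a:ℤ) + 1) (A + (n - 1 - r)) with h2 | h2
  · refine ⟨1, u - n * u, fun x hx => ?_⟩
    rw [(key x hx).1, Ff_2 n v r u _ x hv hr0 hr hui (dn_eq n i) (g1.trans hx.1)]
    · rw [zpow_one]; ring
    · refine hx.2.trans ?_
      have : ((a:ℝ) + 1) * v ≤ (A + (n - 1 - r)) * v := by
        refine mul_le_mul_of_nonneg_right ?_ hv.le
        have := (Int.cast_le (R := ℝ)).2 h2
        push_cast at this
        exact this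
      linarith
  have g2 : u + (n - 1 - r) * v ≤ a * v := by
    have : ((A:ℝ) + (n - 1 - r)) * v ≤ a * v := by
      gcongr; exact_mod_cast (by omega : A + (n - 1 - r) ≤ a)
    linarith
  rcases le_or_gt ((a:ℤ) + 1) (A + n) with h3 | h3
  · refine ⟨0, dn n i, fun x hx => ?_⟩
    rw [(key x hx).1, Ff_3 n v r u _ x hv hr0 hr hui (dn_eq n i) (g2.trans hx.1)]
    · simp
    · refine hx.2.trans ?_
      have : ((a:ℝ) + 1) * v ≤ (A + n) * v :=
        mul_le_mul_of_nonneg_right (by exact_mod_cast h3) hv.le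
      linarith
  · refine ⟨-1, 1 - 1 / n, fun x hx => ?_⟩
    have g3 : u + n * v ≤ a * v := by
      have : ((A:ℝ) + n) * v ≤ a * v := by
        gcongr; exact_mod_cast (by omega : A + n ≤ a)
      linarith
    rw [(key x hx).1, Ff_4 n v r u _ x hv hr0 hr hui (dn_eq n i) (g3.trans hx.1) (key x hx).2]
    rw [zpow_neg_one]
    field_simp
    ring

theorem X_inT (i : ℕ) : InT n (X n i) := by
  have hn0 := n_pos n
  have hp := (phi_mem n i (Nat.cast_nonneg i)).1
  refine ⟨circ_nadic n _ _ _ (nadic_phi_i n i) (nadic_dn n i), Fl n (phi n i) (dn n i),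
    Fl_strictMono n _ _ hp, Fl_isLift n _ _ hp, ?_, ?_⟩
  · intro x; unfold Fl; simp; ring
  · have hv := vn_pos n i
    choose! s c hsc using X_piece n i
    refine ⟨n ^ (i / (n - 1) + 2), fun a => a * vn n i, s, c, ?_, by simp, ?_, ?_, ?_, ?_⟩
    · exact pow_pos (by exact_mod_cast hn0) _
    · unfold vn; push_cast; field_simp
    · intro a _; push_cast; gcongr; linarith
    · intro a _; exact nadic_mul n _ _ (nadic_nat n a) (nadic_vn n i)
    · intro a ha x hx
      exact hsc a ha x (by simpa using hx)

/-- Rotation by `1/n`. -/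
def rot (n : ℕ) : Circle ≃ₜ Circle := Homeomorph.addRight (((1 / n : ℝ) : ℝ) : Circle)

theorem rot_apply (x : ℝ) : rot n (x : Circle) = ((x + 1 / n : ℝ) : Circle) := by
  simp [rot]

theorem rot_symm_apply (x : ℝ) : (rot n).symm (x : Circle) = ((x - 1 / n : ℝ) : Circle) := by
  rw [Homeomorph.symm_apply_eq, rot_apply]; simp

theorem rot_inT : InT n (rot n) := by
  have hd := nadic_div n _ (nadic_one n)
  refine ⟨?_, fun x => x + 1 / n, ?_, fun x => rot_apply n x, fun x => by ring, 1, fun i => i,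
    fun _ => 0, fun _ => 1 / n, one_pos, by simp, by simp, by simp, ?_, ?_⟩
  · apply Set.Subset.antisymm
    · rintro _ ⟨_, ⟨x, hx, rfl⟩, rfl⟩
      exact ⟨x + 1 / n, nadic_add n _ _ hx hd, rot_apply n x⟩
    · rintro _ ⟨x, hx, rfl⟩
      exact ⟨(rot n).symm x, ⟨x - 1 / n, nadic_sub n _ _ hx hd, rot_symm_apply n x⟩, by simp⟩
  · intro x y h; simpa using h
  · intro i _; exact nadic_nat n i
  · intro i _ x _; simp

end inT

set_option linter.unusedSectionVars false
section tlevel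
variable (n : ℕ) [hn : Fact (2 ≤ n)]

/-- `f` maps the standard interval `I` affinely onto the standard interval `J`. -/
def TM (n : ℕ) (f : Circle ≃ₜ Circle) (I J : ℕ × ℕ) : Prop :=
  ∀ t : ℝ, 0 ≤ t → t ≤ 1 →
    f ((((I.2:ℝ) + t) / (n:ℝ) ^ I.1 : ℝ) : Circle) = ((((J.2:ℝ) + t) / (n:ℝ) ^ J.1 : ℝ) : Circle)

/-- The bad standard intervals. -/
def Bad (n : ℕ) (f : Circle ≃ₜ Circle) : Set (ℕ × ℕ) :=
  { I | I.2 < n ^ I.1 ∧ ¬ ∃ J : ℕ × ℕ, J.2 < n ^ J.1 ∧ TM n f I J }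

theorem real_unique (I J : ℕ × ℕ) (h0 : (I.2:ℝ) / (n:ℝ) ^ I.1 = (J.2:ℝ) / (n:ℝ) ^ J.1)
    (h1 : ((I.2:ℝ) + 1 / 2) / (n:ℝ) ^ I.1 = ((J.2:ℝ) + 1 / 2) / (n:ℝ) ^ J.1) : I = J := by
  have hn0 := n_pos n
  have h2 : (n:ℝ) ^ I.1 = (n:ℝ) ^ J.1 := by
    rw [add_div, add_div, h0] at h1
    have := add_left_cancel h1
    field_simp at this
    linarith
  have h3 : I.1 = J.1 := by
    have h4 : n ^ I.1 = n ^ J.1 := by exact_mod_cast h2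
    exact Nat.pow_right_injective hn.out h4
  have h4 : I.2 = J.2 := by
    rw [h2] at h0
    field_simp at h0
    exact_mod_cast h0
  exact Prod.ext h3 h4

theorem std_lt (I : ℕ × ℕ) (hI : I.2 < n ^ I.1) (t : ℝ) (h0 : 0 ≤ t) (h1 : t < 1) :
    0 ≤ ((I.2:ℝ) + t) / (n:ℝ) ^ I.1 ∧ ((I.2:ℝ) + t) / (n:ℝ) ^ I.1 < 1 := by
  have hn0 := n_pos n
  refine ⟨by positivity, ?_⟩
  rw [div_lt_one (by positivity)]
  have : (I.2:ℝ) + 1 ≤ (n:ℝ) ^ I.1 := by exact_mod_cast hI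
  linarith

theorem std_unique (I J : ℕ × ℕ) (hI : I.2 < n ^ I.1) (hJ : J.2 < n ^ J.1)
    (h : ∀ t : ℝ, 0 ≤ t → t ≤ 1 → ((((I.2:ℝ) + t) / (n:ℝ) ^ I.1 : ℝ) : Circle)
      = ((((J.2:ℝ) + t) / (n:ℝ) ^ J.1 : ℝ) : Circle)) : I = J := by
  have key : ∀ t : ℝ, 0 ≤ t → t < 1 → ((I.2:ℝ) + t) / (n:ℝ) ^ I.1 = ((J.2:ℝ) + t) / (n:ℝ) ^ J.1 := by
    intro t h0 h1
    exact coe_inj _ _ (std_lt n I hI t h0 h1).1 (std_lt n I hI t h0 h1).2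
      (std_lt n J hJ t h0 h1).1 (std_lt n J hJ t h0 h1).2 (h t h0 h1.le)
  apply real_unique n
  · simpa using key 0 le_rfl one_pos
  · exact key (1 / 2) (by norm_num) (by norm_num)

theorem hmul_apply (f g : Circle ≃ₜ Circle) (x : Circle) : (f * g) x = f (g x) := rfl

theorem hinv_apply_self (f : Circle ≃ₜ Circle) (x : Circle) : f⁻¹ (f x) = x :=
  f.symm_apply_apply x

theorem TM_comp {f g : Circle ≃ₜ Circle} {I J K : ℕ × ℕ} (h1 : TM n g I J) (h2 : TM n f J K) :
    TM n (f * g) I K := by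
  intro t h0 h
  rw [hmul_apply, h1 t h0 h, h2 t h0 h]

theorem TM_inv {f : Circle ≃ₜ Circle} {I J : ℕ × ℕ} (h1 : TM n f I J) : TM n f⁻¹ J I := by
  intro t h0 h
  rw [← h1 t h0 h, hinv_apply_self]

theorem TM_sub {f : Circle ≃ₜ Circle} {I J : ℕ × ℕ} (h1 : TM n f I J) (j c : ℕ) (hc : c < n ^ j) :
    TM n f (I.1 + j, I.2 * n ^ j + c) (J.1 + j, J.2 * n ^ j + c) := by
  have hn0 := n_pos n
  intro t h0 h
  have hp : (0:ℝ) < (n:ℝ) ^ j := by positivity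
  have := h1 (((c:ℝ) + t) / (n:ℝ) ^ j) (by positivity) (by
    rw [div_le_one hp]
    have : (c:ℝ) + 1 ≤ (n:ℝ) ^ j := by exact_mod_cast hc
    linarith)
  have e : ∀ I : ℕ × ℕ, (((I.2 * n ^ j + c : ℕ) : ℝ) + t) / (n:ℝ) ^ (I.1 + j)
      = ((I.2:ℝ) + ((c:ℝ) + t) / (n:ℝ) ^ j) / (n:ℝ) ^ I.1 := by
    intro I
    push_cast
    rw [pow_add]
    field_simp
    ring
  simp only
  rw [e I, e J, this]

theorem TM_inj {f : Circle ≃ₜ Circle} {I I' J : ℕ × ℕ} (hI : I.2 < n ^ I.1) (hI' : I'.2 < n ^ I'.1)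
    (h : TM n f I J) (h' : TM n f I' J) : I = I' := by
  apply std_unique n I I' hI hI'
  intro t h0 h1
  apply f.injective
  rw [h t h0 h1, h' t h0 h1]

theorem Bad_mul (f g : Circle ≃ₜ Circle) :
    (Bad n (f * g)).encard ≤ (Bad n g).encard + (Bad n f).encard := by
  set C : Set (ℕ × ℕ) := { I | I.2 < n ^ I.1 ∧ ∃ J ∈ Bad n f, TM n g I J } with hC
  have h1 : Bad n (f * g) ⊆ Bad n g ∪ C := by
    rintro I ⟨hI, h⟩
    by_cases hg : ∃ J : ℕ × ℕ, J.2 < n ^ J.1 ∧ TM n g I J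
    · right
      obtain ⟨J, hJ, hJ2⟩ := hg
      refine ⟨hI, J, ⟨hJ, ?_⟩, hJ2⟩
      rintro ⟨K, hK, hK2⟩
      exact h ⟨K, hK, TM_comp n hJ2 hK2⟩
    · left; exact ⟨hI, hg⟩
  have h2 : C.encard ≤ (Bad n f).encard := by
    have : ∀ I : ℕ × ℕ, ∃ J : ℕ × ℕ, I ∈ C → J ∈ Bad n f ∧ TM n g I J := by
      intro I
      by_cases hI : I ∈ C
      · obtain ⟨_, J, h3, h4⟩ := hI
        exact ⟨J, fun _ => ⟨h3, h4⟩⟩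
      · exact ⟨I, fun h => absurd h hI⟩
    choose φ hφ using this
    refine Set.encard_le_encard_of_injOn (f := φ) (fun I hI => (hφ I hI).1) ?_
    intro I hI I' hI' he
    have a1 := (hφ I hI).2
    have a2 := (hφ I' hI').2
    rw [he] at a1
    exact TM_inj n hI.1 hI'.1 a1 a2
  calc _ ≤ (Bad n g ∪ C).encard := Set.encard_le_encard h1
    _ ≤ (Bad n g).encard + C.encard := Set.encard_union_le _ _
    _ ≤ _ := by gcongr

theorem good_sub {f : Circle ≃ₜ Circle} {K : ℕ}
    (h : ∀ a < n ^ K, ∃ J : ℕ × ℕ, J.2 < n ^ J.1 ∧ TM n f (K, a) J) (k b : ℕ) (hk : K ≤ k)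
    (hb : b < n ^ k) : ∃ J : ℕ × ℕ, J.2 < n ^ J.1 ∧ TM n f (k, b) J := by
  obtain ⟨j, rfl⟩ := Nat.exists_eq_add_of_le hk
  have hp : 0 < n ^ j := pow_pos (by have := hn.out; omega) _
  obtain ⟨J, hJ, hJ2⟩ := h (b / n ^ j) (by
    rw [Nat.div_lt_iff_lt_mul hp, ← pow_add]; exact hb)
  have hm : b % n ^ j < n ^ j := Nat.mod_lt _ hp
  refine ⟨(J.1 + j, J.2 * n ^ j + b % n ^ j), ?_, ?_⟩
  · simp only
    rw [pow_add]
    calc J.2 * n ^ j + b % n ^ j < J.2 * n ^ j + n ^ j := by omega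
      _ = (J.2 + 1) * n ^ j := by ring
      _ ≤ _ := Nat.mul_le_mul_right _ hJ
  · have := TM_sub n hJ2 j _ hm
    simp only [Nat.div_add_mod'] at this
    exact this

theorem Bad_finite_of {f : Circle ≃ₜ Circle} {K : ℕ}
    (h : ∀ a < n ^ K, ∃ J : ℕ × ℕ, J.2 < n ^ J.1 ∧ TM n f (K, a) J) : (Bad n f).Finite := by
  refine Set.Finite.subset (Finset.finite_toSet (Finset.range K ×ˢ Finset.range (n ^ K))) ?_
  rintro ⟨k, b⟩ ⟨hb, hI⟩
  have hk : k < K := by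
    by_contra hk
    exact hI (good_sub n h k b (not_lt.1 hk) hb)
  simp only [Finset.coe_product, Finset.coe_range, Set.mem_prod, Set.mem_Iio]
  exact ⟨hk, hb.trans_le (Nat.pow_le_pow_right (by have := hn.out; omega) hk.le)⟩

theorem exists_good {f : Circle ≃ₜ Circle} (h : (Bad n f).Finite) :
    ∃ K, ∀ a < n ^ K, ∃ J : ℕ × ℕ, J.2 < n ^ J.1 ∧ TM n f (K, a) J := by
  obtain ⟨M, hM⟩ := (h.image Prod.fst).bddAbove
  refine ⟨M + 1, fun a ha => ?_⟩
  by_contra hc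
  have := hM ⟨(M + 1, a), ⟨ha, hc⟩, rfl⟩
  simp at this

theorem Bad_inv {f : Circle ≃ₜ Circle} (h : (Bad n f).Finite) : (Bad n f⁻¹).Finite := by
  have hn0 := n_pos n
  obtain ⟨K, hK⟩ := exists_good n h
  choose! J hJ hT using hK
  set M := (Finset.range (n ^ K)).sup (fun a => (J a).1) with hM
  refine Bad_finite_of n (K := M) (fun b hb => ?_)
  obtain ⟨x, hx0, hx1, hx⟩ := exists_coe (f⁻¹ (((((b:ℝ) + 1 / 2) / (n:ℝ) ^ M) : ℝ) : Circle))
  set a := ⌊x * (n:ℝ) ^ K⌋₊ with ha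
  have hp : (0:ℝ) < (n:ℝ) ^ K := by positivity
  have ha1 : (a:ℝ) ≤ x * (n:ℝ) ^ K := Nat.floor_le (by positivity)
  have ha2 : x * (n:ℝ) ^ K < a + 1 := Nat.lt_floor_add_one _
  have haK : a < n ^ K := by
    have : (a:ℝ) < (n:ℝ) ^ K := by nlinarith
    exact_mod_cast this
  have hxe : x = (a + (x * (n:ℝ) ^ K - a)) / (n:ℝ) ^ K := by field_simp; ring
  have hTa := hT a haK (x * (n:ℝ) ^ K - a) (by linarith) (by linarith)
  simp only at hTa
  rw [← hxe, ← hx] at hTa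
  have hff : f (f⁻¹ (((((b:ℝ) + 1 / 2) / (n:ℝ) ^ M) : ℝ) : Circle)) = ((((b:ℝ) + 1 / 2) / (n:ℝ) ^ M : ℝ) : Circle) :=
    f.apply_symm_apply _
  rw [hff] at hTa
  have s1 := std_lt n (M, b) hb (1 / 2) (by norm_num) (by norm_num)
  have s2 := std_lt n (J a) (hJ a haK) (x * (n:ℝ) ^ K - a) (by linarith) (by linarith)
  have e := coe_inj _ _ s1.1 s1.2 s2.1 s2.2 hTa
  have hle : (J a).1 ≤ M := Finset.le_sup (f := fun a => (J a).1) (Finset.mem_range.2 haK)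
  obtain ⟨j, hj⟩ := Nat.exists_eq_add_of_le hle
  set t := x * (n:ℝ) ^ K - a with ht
  have ht0 : 0 ≤ t := by linarith
  have ht1 : t < 1 := by linarith
  have e2 : (b:ℝ) + 1 / 2 = ((J a).2 + t) * (n:ℝ) ^ j := by
    rw [hj, pow_add] at e
    field_simp at e
    linarith
  have hpj : (0:ℝ) < (n:ℝ) ^ j := by positivity
  have b1 : (J a).2 * n ^ j ≤ b := by
    have : ((J a).2:ℝ) * (n:ℝ) ^ j < b + 1 := by nlinarith
    have : (J a).2 * n ^ j < b + 1 := by exact_mod_cast this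
    omega
  have b2 : b < (J a).2 * n ^ j + n ^ j := by
    have : (b:ℝ) < (J a).2 * (n:ℝ) ^ j + (n:ℝ) ^ j := by nlinarith
    exact_mod_cast this
  obtain ⟨c, hc⟩ := Nat.exists_eq_add_of_le b1
  have hcj : c < n ^ j := by omega
  refine ⟨(K + j, a * n ^ j + c), ?_, ?_⟩
  · simp only
    rw [pow_add]
    calc a * n ^ j + c < a * n ^ j + n ^ j := by omega
      _ = (a + 1) * n ^ j := by ring
      _ ≤ _ := Nat.mul_le_mul_right _ haK
  · have := TM_sub n (TM_inv n (hT a haK)) j c hcj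
    rw [← hj, ← hc] at this
    exact this

theorem nadic_ev (x : ℝ) (hx : IsNAdic n x) :
    ∀ᶠ K : ℕ in Filter.atTop, ∃ z : ℤ, x = (z:ℝ) / (n:ℝ) ^ K := by
  have hn0 := n_pos n
  obtain ⟨a, k, rfl⟩ := hx
  filter_upwards [Filter.eventually_ge_atTop k] with K hK
  obtain ⟨j, rfl⟩ := Nat.exists_eq_add_of_le hK
  refine ⟨a * n ^ j, ?_⟩
  push_cast
  rw [pow_add]
  field_simp

theorem nadic_of_coe (x y : ℝ) (hx : IsNAdic n x) (h : (x : Circle) = (y : Circle)) :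
    IsNAdic n y := by
  have h1 : (((y - x : ℝ)) : Circle) = 0 := by rw [AddCircle.coe_sub, h, sub_self]
  rw [AddCircle.coe_eq_zero_iff] at h1
  obtain ⟨z, hz⟩ := h1
  have : y = x + z := by
    simp at hz; linarith
  rw [this]
  exact nadic_add n _ _ hx (nadic_int n z)

theorem Bad_finite_inT (f : Circle ≃ₜ Circle) (hf : InT n f) : (Bad n f).Finite := by
  have hn0 := n_pos n
  obtain ⟨him, F, hmono, hlift, hper, m, t, s, c, hm, ht0, htm, htlt, htn, hF⟩ := hf
  have hFn : ∀ x, IsNAdic n x → IsNAdic n (F x) := by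
    intro x hx
    have : f (x : Circle) ∈ nAdicPoints n := by
      rw [← him]; exact ⟨_, ⟨x, hx, rfl⟩, rfl⟩
    obtain ⟨y, hy, hy2⟩ := this
    rw [hlift x] at hy2
    exact nadic_of_coe n y _ hy hy2.symm
  have hsn : ∀ k : ℤ, IsNAdic n ((n:ℝ) ^ k) := by
    intro k
    obtain ⟨k, rfl | rfl⟩ := k.eq_nat_or_neg
    · rw [zpow_natCast]; exact_mod_cast nadic_nat n (n ^ k)
    · rw [zpow_neg, zpow_natCast, ← one_div]; exact nadic_inv_pow n k
  have hcn : ∀ i, i < m → IsNAdic n (c i) := by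
    intro i hi
    have h1 := hF i hi (t i) ⟨le_rfl, (htlt i hi).le⟩
    have : c i = F (t i) - (n:ℝ) ^ (s i) * t i := by linarith
    rw [this]
    exact nadic_sub n _ _ (hFn _ (htn i hi.le)) (nadic_mul n _ _ (hsn _) (htn i hi.le))
  have ev1 : ∀ᶠ K : ℕ in Filter.atTop, ∀ i ∈ Finset.range (m + 1), ∃ z : ℤ, t i = (z:ℝ) / (n:ℝ) ^ K := by
    rw [Filter.eventually_all_finset]
    intro i hi
    exact nadic_ev n _ (htn i (by simpa [Nat.lt_succ_iff] using hi))
  have ev2 : ∀ᶠ K : ℕ in Filter.atTop, ∀ i ∈ Finset.range m,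
      ∃ l : ℕ, (K:ℤ) = l + s i ∧ ∃ z : ℤ, c i = (z:ℝ) / (n:ℝ) ^ l := by
    rw [Filter.eventually_all_finset]
    intro i hi
    obtain ⟨L, hL⟩ := Filter.eventually_atTop.1 (nadic_ev n _ (hcn i (by simpa using hi)))
    filter_upwards [Filter.eventually_ge_atTop (L + (s i).toNat)] with K hK
    exact ⟨(K - s i).toNat, by omega, hL _ (by omega)⟩
  obtain ⟨K, hK1, hK2⟩ := (ev1.and ev2).exists
  refine Bad_finite_of n (K := K) (fun a ha => ?_)
  have hp : (0:ℝ) < (n:ℝ) ^ K := by positivity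
  have hax : (a:ℝ) / (n:ℝ) ^ K < 1 := by
    rw [div_lt_one hp]; exact_mod_cast ha
  obtain ⟨i, him', hi1, hi2⟩ : ∃ i, i < m ∧ t i ≤ (a:ℝ) / (n:ℝ) ^ K ∧ (a:ℝ) / (n:ℝ) ^ K < t (i + 1) := by
    by_contra hc
    push Not at hc
    have : ∀ i, i ≤ m → t i ≤ (a:ℝ) / (n:ℝ) ^ K := by
      intro i
      induction i with
      | zero => intro _; rw [ht0]; positivity
      | succ i ih => intro hi; exact hc i (by omega) (ih (by omega))
    have := this m le_rfl
    rw [htm] at this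
    linarith
  obtain ⟨z, hz⟩ := hK1 (i + 1) (by simp; omega)
  obtain ⟨l, hl, z', hz'⟩ := hK2 i (by simpa using him')
  have haz : (a:ℝ) + 1 ≤ z := by
    rw [hz, div_lt_div_iff_of_pos_right hp] at hi2
    have : (a:ℤ) < z := by exact_mod_cast hi2
    exact_mod_cast this
  have hpl : (0:ℤ) < (n:ℤ) ^ l := by
    have := hn.out
    positivity
  have hz0 := Int.emod_nonneg ((a:ℤ) + z') hpl.ne'
  have hz1 := Int.emod_lt_of_pos ((a:ℤ) + z') hpl
  refine ⟨(l, (((a:ℤ) + z') % (n:ℤ) ^ l).toNat), ?_, ?_⟩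
  · simp only
    zify
    rw [Int.toNat_of_nonneg hz0]
    exact hz1
  · intro τ h0 h1
    simp only
    have hmem : ((a:ℝ) + τ) / (n:ℝ) ^ K ∈ Set.Icc (t i) (t (i + 1)) := by
      constructor
      · refine hi1.trans ?_
        gcongr; linarith
      · rw [hz]; gcongr; linarith
    rw [hlift, hF i him' _ hmem, hz']
    have hzp : (n:ℝ) ^ (s i) * (n:ℝ) ^ l = (n:ℝ) ^ K := by
      rw [← zpow_natCast, ← zpow_natCast, ← zpow_add₀ hn0.ne', hl, add_comm]
    have hcast : (((((a:ℤ) + z') % (n:ℤ) ^ l).toNat : ℕ) : ℝ)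
        = (a:ℝ) + z' - (n:ℝ) ^ l * (((a:ℤ) + z') / (n:ℤ) ^ l : ℤ) := by
      have h3 : (((((a:ℤ) + z') % (n:ℤ) ^ l).toNat : ℕ) : ℤ) = (a:ℤ) + z' - (n:ℤ) ^ l * (((a:ℤ) + z') / (n:ℤ) ^ l) := by
        rw [Int.toNat_of_nonneg hz0, Int.emod_def]
      exact_mod_cast congrArg (Int.cast (R := ℝ)) h3
    rw [hcast, ← coe_add_int _ (((a:ℤ) + z') / (n:ℤ) ^ l)]
    rw [← coe_add_int (_ / (n:ℝ) ^ l) (((a:ℤ) + z') / (n:ℤ) ^ l)]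
    rw [coe_add_int]
    congr 1
    have hpl' : (0:ℝ) < (n:ℝ) ^ l := by positivity
    have hsz : (n:ℝ) ^ (s i) = (n:ℝ) ^ K / (n:ℝ) ^ l := by rw [← hzp]; field_simp
    rw [hsz]
    field_simp
    ring

theorem Bad_finite_Tn (f : Circle ≃ₜ Circle) (hf : f ∈ Tn n) : (Bad n f).Finite := by
  unfold Tn at hf
  induction hf using Subgroup.closure_induction with
  | mem x hx => exact Bad_finite_inT n x hx
  | one =>
    refine Bad_finite_of n (K := 0) (fun a ha => ⟨(0, a), ha, fun t _ _ => rfl⟩)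
  | mul x y _ _ hx hy =>
    have := Bad_mul n x y
    rw [← Set.encard_lt_top_iff]
    exact this.trans_lt (WithTop.add_lt_top.2 ⟨hy.encard_lt_top, hx.encard_lt_top⟩)
  | inv x _ hx => exact Bad_inv n hx

end tlevel

set_option linter.unusedSectionVars false
section flevel
variable (n : ℕ) [hn : Fact (2 ≤ n)]

/-- Affine matching of intervals in the half line coordinate. -/
def MM (n : ℕ) (f : Circle ≃ₜ Circle) (I J : ℕ × ℕ) : Prop :=
  ∀ t : ℝ, 0 ≤ t → t ≤ 1 →
    f (psi n (((I.2:ℝ) + t) / (n:ℝ) ^ I.1)) = psi n (((J.2:ℝ) + t) / (n:ℝ) ^ J.1)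

/-- Bad intervals in the half line coordinate. -/
def NB (n : ℕ) (f : Circle ≃ₜ Circle) : Set (ℕ × ℕ) := { I | ¬ ∃ J : ℕ × ℕ, MM n f I J }

theorem MM_comp {f g : Circle ≃ₜ Circle} {I J K : ℕ × ℕ} (h1 : MM n g I J) (h2 : MM n f J K) :
    MM n (f * g) I K := by
  intro t h0 h
  rw [hmul_apply, h1 t h0 h, h2 t h0 h]

theorem MM_inv {f : Circle ≃ₜ Circle} {I J : ℕ × ℕ} (h1 : MM n f I J) : MM n f⁻¹ J I := by
  intro t h0 h
  rw [← h1 t h0 h, hinv_apply_self]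

theorem MM_sub {f : Circle ≃ₜ Circle} {I J : ℕ × ℕ} (h1 : MM n f I J) (j c : ℕ) (hc : c < n ^ j) :
    MM n f (I.1 + j, I.2 * n ^ j + c) (J.1 + j, J.2 * n ^ j + c) := by
  have hn0 := n_pos n
  intro t h0 h
  have hp : (0:ℝ) < (n:ℝ) ^ j := by positivity
  have := h1 (((c:ℝ) + t) / (n:ℝ) ^ j) (by positivity) (by
    rw [div_le_one hp]
    have : (c:ℝ) + 1 ≤ (n:ℝ) ^ j := by exact_mod_cast hc
    linarith)
  have e : ∀ I : ℕ × ℕ, (((I.2 * n ^ j + c : ℕ) : ℝ) + t) / (n:ℝ) ^ (I.1 + j)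
      = ((I.2:ℝ) + ((c:ℝ) + t) / (n:ℝ) ^ j) / (n:ℝ) ^ I.1 := by
    intro I
    push_cast
    rw [pow_add]
    field_simp
    ring
  simp only
  rw [e I, e J, this]

theorem MM_inj {f : Circle ≃ₜ Circle} {I I' J : ℕ × ℕ} (h : MM n f I J) (h' : MM n f I' J) : I = I' := by
  have hn0 := n_pos n
  have key : ∀ t : ℝ, 0 ≤ t → t ≤ 1 → ((I.2:ℝ) + t) / (n:ℝ) ^ I.1 = ((I'.2:ℝ) + t) / (n:ℝ) ^ I'.1 := by
    intro t h0 h1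
    apply psi_inj n _ _ (by positivity) (by positivity)
    apply f.injective
    rw [h t h0 h1, h' t h0 h1]
  apply real_unique n
  · simpa using key 0 le_rfl zero_le_one
  · exact key (1 / 2) (by norm_num) (by norm_num)

theorem toT (I : ℕ × ℕ) : ∃ A : ℕ × ℕ, A.2 + 1 < n ^ A.1 ∧ ∀ t : ℝ, 0 ≤ t → t ≤ 1 →
    phi n (((I.2:ℝ) + t) / (n:ℝ) ^ I.1) = ((A.2:ℝ) + t) / (n:ℝ) ^ A.1 := by
  obtain ⟨k, m⟩ := I
  have hn0 := n_pos n
  have hp : 0 < n ^ k := pow_pos (by have := hn.out; omega) _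
  set j := m / n ^ k with hj
  set a := m % n ^ k with ha
  have hm : m = j * n ^ k + a := (Nat.div_add_mod' m (n ^ k)).symm
  have hak : a < n ^ k := Nat.mod_lt _ hp
  have hr := r_le n j
  have hr' : j % (n - 1) + 2 ≤ n := by exact_mod_cast hr
  have hphi := phi_i n j
  have hadd := phi_i_add n j
  unfold vn at hphi hadd
  generalize j / (n - 1) = q at *
  generalize j % (n - 1) = r at *
  have hnq : n ≤ n ^ (q + 1) := Nat.le_self_pow (by omega) n
  obtain ⟨c, hc⟩ : ∃ c, c + n = n ^ (q + 1) + r := ⟨n ^ (q + 1) + r - n, by omega⟩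
  have hcR : (c:ℝ) + n = (n:ℝ) ^ (q + 1) + r := by exact_mod_cast hc
  refine ⟨(q + 1 + k, c * n ^ k + a), ?_, ?_⟩
  · simp only
    calc c * n ^ k + a + 1 ≤ (c + 1) * n ^ k := by linarith
      _ < (c + 2) * n ^ k := by gcongr; omega
      _ ≤ n ^ (q + 1) * n ^ k := by gcongr; omega
      _ = _ := (pow_add _ _ _).symm
  · intro t h0 h1
    simp only
    have hpR : (0:ℝ) < (n:ℝ) ^ k := by positivity
    have e1 : ((m:ℝ) + t) / (n:ℝ) ^ k = j + (a + t) / (n:ℝ) ^ k := by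
      rw [hm]; push_cast; field_simp; ring
    rw [e1, hadd _ (by positivity), hphi]
    · have e2 : (n:ℝ) ^ (q + 1) = c + n - r := by linarith
      have e3 : (n:ℝ) ^ (q + 2) = n * (n:ℝ) ^ (q + 1) := by ring
      have hq : (0:ℝ) < (n:ℝ) ^ (q + 1) := by positivity
      rw [e3, pow_add (n:ℝ) (q + 1) k]
      push_cast
      field_simp
      rw [e2]
      ring
    · have : (a + t) / (n:ℝ) ^ k ≤ 1 := by
        rw [div_le_one hpR]
        have : (a:ℝ) + 1 ≤ (n:ℝ) ^ k := by exact_mod_cast hak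
        linarith
      linarith

theorem fromT (l : ℕ) : ∀ b : ℕ, b + 1 < n ^ l → ∃ I : ℕ × ℕ, ∀ t : ℝ, 0 ≤ t → t ≤ 1 →
    phi n (((I.2:ℝ) + t) / (n:ℝ) ^ I.1) = ((b:ℝ) + t) / (n:ℝ) ^ l := by
  have hn0 := n_pos n
  have hn2 := n_ge n
  induction l with
  | zero => intro b hb; simp at hb
  | succ l ih =>
    intro b hb
    have hp : (0:ℝ) < (n:ℝ) ^ l := by positivity
    have hc1 := cast_sub_one n
    rcases lt_or_ge b ((n - 1) * n ^ l) with h | h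
    · refine ⟨(l, b), fun t h0 h1 => ?_⟩
      simp only
      rw [phi_base n _ (by positivity)]
      · rw [pow_succ]; field_simp
      · rw [div_le_iff₀ hp, ← hc1]
        have : (b:ℝ) + 1 ≤ (n - 1 : ℕ) * (n:ℝ) ^ l := by exact_mod_cast h
        linarith
    · obtain ⟨b', rfl⟩ := Nat.exists_eq_add_of_le h
      have hpow : n ^ (l + 1) = (n - 1) * n ^ l + n ^ l := by
        obtain ⟨n', rfl⟩ := Nat.exists_eq_add_of_le hn.out
        rw [show 2 + n' - 1 = n' + 1 by omega]; ring
      obtain ⟨I, hI⟩ := ih b' (by omega)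
      refine ⟨(I.1, I.2 + (n - 1) * n ^ I.1), fun t h0 h1 => ?_⟩
      have e : (((I.2 + (n - 1) * n ^ I.1 : ℕ) : ℝ) + t) / (n:ℝ) ^ I.1
          = ((I.2:ℝ) + t) / (n:ℝ) ^ I.1 + ((n:ℝ) - 1) := by
        push_cast; rw [hc1]; field_simp; ring
      simp only
      rw [e, phi_shift n _ (by positivity), hI t h0 h1]
      push_cast
      rw [hc1, pow_succ]
      field_simp
      ring

theorem nonspine_image {f : Circle ≃ₜ Circle} (hf : f ((0:ℝ) : Circle) = ((0:ℝ) : Circle))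
    {A B : ℕ × ℕ} (hA : A.2 + 1 < n ^ A.1) (hB : B.2 < n ^ B.1) (h : TM n f A B) :
    B.2 + 1 < n ^ B.1 := by
  have hn0 := n_pos n
  rcases lt_or_eq_of_le (Nat.succ_le_of_lt hB) with h1 | h1
  · exact h1
  · exfalso
    have h2 := h 1 zero_le_one le_rfl
    have h3 : (B.2:ℝ) + 1 = (n:ℝ) ^ B.1 := by exact_mod_cast h1
    rw [h3, div_self (by positivity), coe_one', ← hf] at h2
    have h4 := f.injective h2
    have h5 : ((A.2:ℝ) + 1) < (n:ℝ) ^ A.1 := by exact_mod_cast hA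
    have h6 := coe_inj _ _ (by positivity) (by rw [div_lt_one (by positivity)]; exact h5) le_rfl one_pos h4
    have : 0 < ((A.2:ℝ) + 1) / (n:ℝ) ^ A.1 := by positivity
    linarith

/-- The bad spine levels. -/
def SB (n : ℕ) (f : Circle ≃ₜ Circle) : Set ℕ := { k | (k, n ^ k - 1) ∈ Bad n f }

theorem NB_add_SB {f : Circle ≃ₜ Circle} (hf : f ((0:ℝ) : Circle) = ((0:ℝ) : Circle)) :
    (NB n f).encard + (SB n f).encard ≤ (Bad n f).encard := by
  have hn0 := n_pos n
  choose τ hτ1 hτ2 using toT n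
  have hinj : Function.Injective τ := by
    intro I I' h
    have key : ∀ t : ℝ, 0 ≤ t → t ≤ 1 → ((I.2:ℝ) + t) / (n:ℝ) ^ I.1 = ((I'.2:ℝ) + t) / (n:ℝ) ^ I'.1 := by
      intro t h0 h1
      apply phi_inj n _ _ (by positivity) (by positivity)
      rw [hτ2 I t h0 h1, hτ2 I' t h0 h1, h]
    apply real_unique n
    · simpa using key 0 le_rfl zero_le_one
    · exact key (1 / 2) (by norm_num) (by norm_num)
  have hinj2 : Function.Injective (fun k : ℕ => (k, n ^ k - 1)) := by
    intro k k' h; exact (Prod.ext_iff.1 h).1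
  rw [← hinj.encard_image, ← hinj2.encard_image, ← Set.encard_union_eq]
  · apply Set.encard_le_encard
    apply Set.union_subset
    · rintro _ ⟨I, hI, rfl⟩
      refine ⟨by have := hτ1 I; omega, ?_⟩
      rintro ⟨B, hB, hT⟩
      have hB2 := nonspine_image n hf (hτ1 I) hB hT
      obtain ⟨I', hI'⟩ := fromT n B.1 B.2 hB2
      apply hI
      refine ⟨I', fun t h0 h1 => ?_⟩
      rw [psi, psi, hI' t h0 h1, hτ2 I t h0 h1]
      exact hT t h0 h1
    · rintro _ ⟨k, hk, rfl⟩
      exact hk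
  · rw [Set.disjoint_left]
    rintro _ ⟨I, _, rfl⟩ ⟨k, _, h⟩
    have h1 := hτ1 I
    rw [← h] at h1
    simp only at h1
    omega

theorem spine_MM {f : Circle ≃ₜ Circle} (hf : f ((0:ℝ) : Circle) = ((0:ℝ) : Circle)) (k : ℕ)
    (hk : k ∉ SB n f) (m : ℕ) (hm : k * (n - 1) ≤ m) : (0, m) ∉ NB n f := by
  have hn0 := n_pos n
  have hp : 0 < n ^ k := pow_pos (by have := hn.out; omega) _
  have hgood : ∃ J : ℕ × ℕ, J.2 < n ^ J.1 ∧ TM n f (k, n ^ k - 1) J := by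
    by_contra hc
    exact hk ⟨by simp only; omega, hc⟩
  obtain ⟨⟨l, b⟩, hb, hT⟩ := hgood
  simp only at hb
  have hcast : ∀ k : ℕ, ((n ^ k - 1 : ℕ) : ℝ) = (n:ℝ) ^ k - 1 := by
    intro k
    have : 1 ≤ n ^ k := Nat.one_le_pow _ _ (by have := hn.out; omega)
    push_cast [Nat.cast_sub this]; rfl
  have hbl : (b:ℝ) = (n:ℝ) ^ l - 1 := by
    have h1 := hT 1 zero_le_one le_rfl
    simp only at h1
    rw [hcast, sub_add_cancel, div_self (by positivity), coe_one', hf] at h1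
    have h2 : (b:ℝ) + 1 ≤ (n:ℝ) ^ l := by exact_mod_cast hb
    rcases lt_or_eq_of_le h2 with h3 | h3
    · have h6 := coe_inj _ _ le_rfl one_pos (by positivity) (by rw [div_lt_one (by positivity)]; exact h3) h1
      have : 0 < ((b:ℝ) + 1) / (n:ℝ) ^ l := by positivity
      linarith
    · linarith
  obtain ⟨p, rfl⟩ := Nat.exists_eq_add_of_le hm
  intro hc
  apply hc
  refine ⟨(0, l * (n - 1) + p), fun t h0 h1 => ?_⟩
  simp only [pow_zero, div_one]
  push_cast
  rw [cast_sub_one]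
  have e : ∀ k : ℕ, (k:ℝ) * ((n:ℝ) - 1) + p + t = (p + t) + k * ((n:ℝ) - 1) := by intro k; ring
  rw [e, e, psi, psi, phi_shift_k n _ _ (by positivity), phi_shift_k n _ _ (by positivity)]
  have hm := phi_mem n (p + t) (by positivity)
  have := hT (phi n (p + t)) hm.1 hm.2.le
  simp only at this
  rw [hcast, hbl] at this
  have e2 : ∀ k : ℕ, ((n:ℝ) ^ k - 1 + phi n (p + t)) / (n:ℝ) ^ k = 1 - (1 - phi n (p + t)) / (n:ℝ) ^ k := by
    intro k; field_simp; ring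
  rw [e2, e2] at this
  exact this

theorem spine_bound {f : Circle ≃ₜ Circle} (hf : f ((0:ℝ) : Circle) = ((0:ℝ) : Circle))
    (hfin : (SB n f).Finite) (m : ℕ) (hm : (SB n f).ncard * (n - 1) ≤ m) : (0, m) ∉ NB n f := by
  obtain ⟨k, hk, hk2⟩ : ∃ k, k ≤ (SB n f).ncard ∧ k ∉ SB n f := by
    by_contra hc
    push Not at hc
    have : ((Finset.range ((SB n f).ncard + 1) : Finset ℕ) : Set ℕ) ⊆ SB n f := by
      intro k hk
      exact hc k (by simpa [Nat.lt_succ_iff] using hk)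
    have := Set.ncard_le_ncard this hfin
    rw [Set.ncard_coe_finset, Finset.card_range] at this
    omega
  exact spine_MM n hf k hk2 m ((Nat.mul_le_mul_right _ hk).trans hm)

theorem XM1 (i k m : ℕ) (h : m + 1 ≤ i * n ^ k) : MM n (X n i) (k, m) (k, m) := by
  have hn0 := n_pos n
  intro t h0 h1
  apply X_1 n i _ (by positivity)
  simp only
  rw [div_le_iff₀ (by positivity)]
  have : (m:ℝ) + 1 ≤ i * (n:ℝ) ^ k := by exact_mod_cast h
  linarith

theorem XM2 (i k p : ℕ) (h : i * n ^ k ≤ p) (h' : p + 1 ≤ (i + n) * n ^ k) :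
    MM n (X n i) (k + 1, p + (n - 1) * i * n ^ k) (k, p) := by
  have hn0 := n_pos n
  have hpk : (0:ℝ) < (n:ℝ) ^ k := by positivity
  intro t h0 h1
  simp only
  have e1 : (((p + (n - 1) * i * n ^ k : ℕ):ℝ) + t) / (n:ℝ) ^ (k + 1)
     = i + ((p + t) / (n:ℝ) ^ k - i) / n := by
    push_cast
    rw [cast_sub_one]
    field_simp
    ring
  have c1 : (i:ℝ) * (n:ℝ) ^ k ≤ p := by exact_mod_cast h
  have c2 : (p:ℝ) + 1 ≤ ((i:ℝ) + n) * (n:ℝ) ^ k := by exact_mod_cast h'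
  have g1 : (i:ℝ) ≤ (p + t) / (n:ℝ) ^ k := by rw [le_div_iff₀ hpk]; linarith
  have g2 : (p + t) / (n:ℝ) ^ k ≤ i + n := by rw [div_le_iff₀ hpk]; linarith
  rw [e1, X_2 n i]
  · congr 1; field_simp; ring
  · apply div_nonneg _ hn0.le; linarith
  · rw [div_le_one hn0]; linarith

theorem XM3 (i k m : ℕ) (h : (i + 1) * n ^ k ≤ m) :
    MM n (X n i) (k, m) (k, m + (n - 1) * n ^ k) := by
  have hn0 := n_pos n
  have hpk : (0:ℝ) < (n:ℝ) ^ k := by positivity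
  have c1 : ((i:ℝ) + 1) * (n:ℝ) ^ k ≤ m := by exact_mod_cast h
  intro t h0 h1
  rw [X_3 n i]
  · congr 1
    push_cast
    rw [cast_sub_one]
    field_simp
    ring
  · simp only
    rw [le_div_iff₀ hpk]; linarith

theorem X_fwd (i : ℕ) (I : ℕ × ℕ) (hI : I ≠ (0, i)) : ∃ J, MM n (X n i) I J := by
  obtain ⟨k, m⟩ := I
  rcases le_or_gt (m + 1) (i * n ^ k) with h | h
  · exact ⟨_, XM1 n i k m h⟩
  rcases le_or_gt ((i + 1) * n ^ k) m with h2 | h2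
  · exact ⟨_, XM3 n i k m h2⟩
  rcases k with _ | k
  · exfalso; apply hI; simp at h h2; ext <;> simp; omega
  · have hn1 : 1 ≤ n := by have := hn.out; omega
    have e : (n - 1) * i * n ^ k + i * n ^ k = i * n ^ (k + 1) := by
      obtain ⟨n', rfl⟩ := Nat.exists_eq_add_of_le hn1
      rw [show 1 + n' - 1 = n' by omega]; ring
    obtain ⟨p, rfl⟩ : ∃ p, m = p + (n - 1) * i * n ^ k :=
      ⟨m - (n - 1) * i * n ^ k, by omega⟩
    refine ⟨_, XM2 n i k p (by omega) ?_⟩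
    have e2 : (i + 1) * n ^ (k + 1) = i * n ^ (k + 1) + n * n ^ k := by ring
    have e3 : (i + n) * n ^ k = i * n ^ k + n * n ^ k := by ring
    omega

theorem X_bwd (i : ℕ) (J : ℕ × ℕ) : ∃ I, I ≠ (0, i) ∧ MM n (X n i) I J := by
  obtain ⟨k, p⟩ := J
  have hn1 : 1 ≤ n := by have := hn.out; omega
  have hpk : 0 < n ^ k := pow_pos (by omega) _
  rcases le_or_gt (p + 1) (i * n ^ k) with h | h
  · refine ⟨_, ?_, XM1 n i k p h⟩
    rintro h2
    rw [Prod.mk.injEq] at h2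
    obtain ⟨rfl, rfl⟩ := h2
    simp at h
  rcases le_or_gt (p + 1) ((i + n) * n ^ k) with h2 | h2
  · refine ⟨_, ?_, XM2 n i k p (by omega) h2⟩
    intro h3
    rw [Prod.mk.injEq] at h3
    omega
  · have e : (i + 1) * n ^ k + (n - 1) * n ^ k = (i + n) * n ^ k := by
      obtain ⟨n', rfl⟩ := Nat.exists_eq_add_of_le hn1
      rw [show 1 + n' - 1 = n' by omega]; ring
    obtain ⟨m, rfl⟩ : ∃ m, p = m + (n - 1) * n ^ k := ⟨p - (n - 1) * n ^ k, by omega⟩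
    refine ⟨_, ?_, XM3 n i k m (by omega)⟩
    intro h3
    rw [Prod.mk.injEq] at h3
    obtain ⟨rfl, rfl⟩ := h3
    simp at h2
    omega

end flevel

set_option linter.unusedSectionVars false
section words

/-- `g` is a product of at most `k` elements of `S ∪ S⁻¹`. -/
def HasLen {G : Type*} [Group G] (S : Set G) (g : G) (k : ℕ) : Prop :=
  ∃ w : List G, w.length ≤ k ∧ (∀ x ∈ w, x ∈ S ∨ x⁻¹ ∈ S) ∧ w.prod = g

theorem HasLen.mul {G : Type*} [Group G] {S : Set G} {g h : G} {k l : ℕ} (hg : HasLen S g k)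
    (hh : HasLen S h l) : HasLen S (g * h) (k + l) := by
  obtain ⟨w, h1, h2, rfl⟩ := hg
  obtain ⟨v, h3, h4, rfl⟩ := hh
  refine ⟨w ++ v, by simp; omega, ?_, by simp⟩
  intro x hx
  rcases List.mem_append.1 hx with hx | hx
  · exact h2 x hx
  · exact h4 x hx

theorem HasLen.mono {G : Type*} [Group G] {S : Set G} {g : G} {k l : ℕ} (hg : HasLen S g k)
    (h : k ≤ l) : HasLen S g l := by
  obtain ⟨w, h1, h2, rfl⟩ := hg
  exact ⟨w, h1.trans h, h2, rfl⟩

theorem HasLen.one {G : Type*} [Group G] (S : Set G) (k : ℕ) : HasLen S (1 : G) k :=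
  ⟨[], by simp, by simp, by simp⟩

theorem HasLen.gen {G : Type*} [Group G] {S : Set G} {g : G} (h : g ∈ S) : HasLen S g 1 :=
  ⟨[g], by simp, by simp [h], by simp⟩

theorem HasLen.inv {G : Type*} [Group G] {S : Set G} {g : G} {k : ℕ} (hg : HasLen S g k) :
    HasLen S g⁻¹ k := by
  obtain ⟨w, h1, h2, rfl⟩ := hg
  refine ⟨(w.map (·⁻¹)).reverse, by simpa using h1, ?_, by rw [List.prod_inv_reverse]⟩
  intro x hx
  simp only [List.mem_reverse, List.mem_map] at hx
  obtain ⟨y, hy, rfl⟩ := hx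
  rw [inv_inv]
  exact (h2 y hy).symm

theorem HasLen.pow {G : Type*} [Group G] {S : Set G} {g : G} (h : g ∈ S) (k : ℕ) :
    HasLen S (g ^ k) k := by
  induction k with
  | zero => simpa using HasLen.one S 0
  | succ k ih => rw [pow_succ]; exact ih.mul (HasLen.gen h)

theorem HasLen.mem_closure {G : Type*} [Group G] {S : Set G} {g : G} {k : ℕ} (hg : HasLen S g k) :
    g ∈ Subgroup.closure S := by
  obtain ⟨w, h1, h2, rfl⟩ := hg
  apply Subgroup.list_prod_mem
  intro x hx
  rcases h2 x hx with h | h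
  · exact Subgroup.subset_closure h
  · simpa using (Subgroup.closure S).inv_mem (Subgroup.subset_closure h)

theorem HasLen.wordLength_le {G : Type*} [Group G] {S : Set G} {g : G} {k : ℕ} (hg : HasLen S g k) :
    wordLength S g ≤ k := by
  obtain ⟨w, h1, h2, h3⟩ := hg
  have : wordLength S g ≤ w.length := Nat.sInf_le ⟨w, rfl, h2, h3⟩
  exact this.trans h1

theorem exists_hasLen {G : Type*} [Group G] {S : Set G} {g : G} (hg : g ∈ Subgroup.closure S) :
    ∃ k, HasLen S g k := by
  induction hg using Subgroup.closure_induction with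
  | mem x hx => exact ⟨1, HasLen.gen hx⟩
  | one => exact ⟨0, HasLen.one S 0⟩
  | mul x y _ _ hx hy =>
    obtain ⟨k, hk⟩ := hx
    obtain ⟨l, hl⟩ := hy
    exact ⟨_, hk.mul hl⟩
  | inv x _ hx =>
    obtain ⟨k, hk⟩ := hx
    exact ⟨_, hk.inv⟩

theorem hasLen_wordLength {G : Type*} [Group G] {S : Set G} {g : G} (hg : g ∈ Subgroup.closure S) :
    HasLen S g (wordLength S g) := by
  obtain ⟨k, w, h1, h2, h3⟩ := exists_hasLen hg
  have := Nat.sInf_mem (s := { k : ℕ | ∃ w : List G, w.length = k ∧ (∀ x ∈ w, x ∈ S ∨ x⁻¹ ∈ S) ∧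
    w.prod = g }) ⟨_, w, rfl, h2, h3⟩
  obtain ⟨w', h1', h2', h3'⟩ := this
  exact ⟨w', h1'.le, h2', h3'⟩

theorem HasLen.map {G H : Type*} [Group G] [Group H] (φ : H →* G) {S : Set H} {g : H} {k : ℕ}
    (hg : HasLen S g k) : HasLen (φ '' S) (φ g) k := by
  obtain ⟨w, h1, h2, rfl⟩ := hg
  refine ⟨w.map φ, by simpa using h1, ?_, (map_list_prod φ w).symm⟩
  intro x hx
  obtain ⟨y, hy, rfl⟩ := List.mem_map.1 hx
  rcases h2 y hy with h | h
  · exact Or.inl ⟨y, h, rfl⟩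
  · exact Or.inr ⟨_, h, map_inv φ y⟩

theorem HasLen.subset {G : Type*} [Group G] {S S' : Set G} {g : G} {k : ℕ}
    (hg : HasLen S g k) (h : S ⊆ S') : HasLen S' g k := by
  obtain ⟨w, h1, h2, rfl⟩ := hg
  exact ⟨w, h1, fun x hx => (h2 x hx).imp (fun a => h a) (fun a => h a), rfl⟩

theorem HasLen.comap {G H : Type*} [Group G] [Group H] (φ : H →* G) (hφ : Function.Injective φ)
    {S : Set H} {g : H} {k : ℕ} (hg : HasLen (φ '' S) (φ g) k) : HasLen S g k := by
  obtain ⟨w, h1, h2, h3⟩ := hg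
  have key : ∀ w : List G, (∀ x ∈ w, x ∈ φ '' S ∨ x⁻¹ ∈ φ '' S) →
      ∃ v : List H, (∀ x ∈ v, x ∈ S ∨ x⁻¹ ∈ S) ∧ v.map φ = w := by
    intro w
    induction w with
    | nil => intro _; exact ⟨[], by simp, rfl⟩
    | cons a w ih =>
      intro h
      obtain ⟨v, hv, rfl⟩ := ih (fun x hx => h x (List.mem_cons_of_mem _ hx))
      rcases h a List.mem_cons_self with ⟨b, hb, rfl⟩ | ⟨b, hb, hb2⟩
      · refine ⟨b :: v, ?_, by simp⟩
        intro x hx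
        rcases List.mem_cons.1 hx with rfl | hx
        · exact Or.inl hb
        · exact hv x hx
      · refine ⟨b⁻¹ :: v, ?_, by simp [hb2]⟩
        intro x hx
        rcases List.mem_cons.1 hx with rfl | hx
        · exact Or.inr (by simpa using hb)
        · exact hv x hx
  obtain ⟨v, hv, rfl⟩ := key w h2
  refine ⟨v, by simpa using h1, hv, hφ ?_⟩
  rw [← h3, map_list_prod]

end words

section algo
variable (n : ℕ) [hn : Fact (2 ≤ n)]

/-- The generators of `F_n` as homeomorphisms. -/
def XS (n : ℕ) [Fact (2 ≤ n)] : Set (Circle ≃ₜ Circle) := { g | ∃ i < n, g = X n i }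

theorem X_rel (i : ℕ) (hi : 1 ≤ i) : X n (i + (n - 1)) * X n 0 = X n 0 * X n i := by
  have hn0 := n_pos n
  have hn2 := n_ge n
  have hi' : (1:ℝ) ≤ i := by exact_mod_cast hi
  have hc : ((i + (n - 1) : ℕ) : ℝ) = i + ((n:ℝ) - 1) := by push_cast; rw [cast_sub_one]
  ext p
  obtain ⟨y, hy, rfl⟩ := psi_surj n p
  rw [hmul_apply, hmul_apply]
  rcases le_or_gt y 1 with h | h
  · rw [X_1 n i y hy (by linarith)]
    have := X_2 n 0 y hy h
    simp only [Nat.cast_zero, zero_add] at this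
    rw [this, X_1 n _ _ (by positivity)]
    rw [hc]; nlinarith
  · rw [X_3 n 0 y (by push_cast; linarith)]
    rcases le_or_gt y i with h2 | h2
    · rw [X_1 n i y hy h2, X_1 n _ _ (by linarith) (by rw [hc]; linarith),
        X_3 n 0 y (by push_cast; linarith)]
    · rcases le_or_gt (i + 1 : ℝ) y with h3 | h3
      · rw [X_3 n i y h3, X_3 n _ _ (by rw [hc]; linarith), X_3 n 0 _ (by push_cast; linarith)]
      · have e1 := X_2 n i (y - i) (by linarith) (by linarith)
        have e2 := X_2 n (i + (n - 1)) (y - i) (by linarith) (by linarith)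
        rw [hc] at e2
        rw [show (i:ℝ) + (y - i) = y by ring] at e1
        rw [show (i:ℝ) + ((n:ℝ) - 1) + (y - i) = y + ((n:ℝ) - 1) by ring] at e2
        rw [e1, e2, X_3 n 0 _ (by push_cast; nlinarith)]
        congr 1; ring

theorem X_rel_pow (i : ℕ) (hi : 1 ≤ i) (q : ℕ) :
    X n (i + q * (n - 1)) * X n 0 ^ q = X n 0 ^ q * X n i := by
  induction q with
  | zero => simp
  | succ q ih =>
    rw [show i + (q + 1) * (n - 1) = (i + q * (n - 1)) + (n - 1) by ring, pow_succ', ← mul_assoc,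
      X_rel n _ (by omega), mul_assoc, ih, mul_assoc]

theorem X_form (i : ℕ) : ∃ ρ < n, X n i = X n 0 ^ ((i - 1) / (n - 1)) * X n ρ *
    (X n 0 ^ ((i - 1) / (n - 1)))⁻¹ := by
  have h2 := hn.out
  rcases Nat.eq_zero_or_pos i with rfl | hi
  · exact ⟨0, by omega, by simp⟩
  · refine ⟨(i - 1) % (n - 1) + 1, ?_, ?_⟩
    · have := Nat.mod_lt (i - 1) (by omega : 0 < n - 1); omega
    · rw [eq_mul_inv_iff_mul_eq, ← X_rel_pow n _ (by omega)]
      congr 2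
      have := Nat.mod_add_div (i - 1) (n - 1)
      rw [mul_comm (n - 1)] at this
      omega

theorem NB_empty_of {f : Circle ≃ₜ Circle} (h : ∀ i, (0, i) ∉ NB n f) : NB n f = ∅ := by
  ext ⟨k, m⟩
  simp only [Set.mem_empty_iff_false, iff_false]
  intro hb
  apply hb
  have hp : 0 < n ^ k := pow_pos (by have := hn.out; omega) _
  have h1 := h (m / n ^ k)
  simp only [NB, Set.mem_ofPred_eq, not_not] at h1
  obtain ⟨J, hJ⟩ := h1
  have := MM_sub n hJ k (m % n ^ k) (Nat.mod_lt _ hp)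
  simp only [zero_add, Nat.div_add_mod'] at this
  exact ⟨_, this⟩

theorem step_card {f : Circle ≃ₜ Circle} (hfin : (NB n f).Finite) (i : ℕ) (hi : (0, i) ∈ NB n f) :
    (NB n (f * (X n i)⁻¹)).Finite ∧ (NB n (f * (X n i)⁻¹)).ncard + 1 ≤ (NB n f).ncard := by
  choose τ hτ1 hτ2 using X_bwd n i
  have hinj : Function.Injective τ := by
    intro J J' h
    have h1 := MM_inv n (hτ2 J)
    have h2 := MM_inv n (hτ2 J')
    rw [h] at h1
    have h3 := MM_inv n h1
    have h4 := MM_inv n h2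
    exact MM_inj n (MM_inv n h3) (MM_inv n h4)
  have hmap : Set.MapsTo τ (NB n (f * (X n i)⁻¹)) (NB n f \ {(0, i)}) := by
    intro J hJ
    refine ⟨?_, hτ1 J⟩
    rintro ⟨K, hK⟩
    exact hJ ⟨K, MM_comp n (MM_inv n (hτ2 J)) hK⟩
  have hfin2 : (NB n f \ {(0, i)}).Finite := hfin.subset Set.sdiff_subset
  have hfin3 : (NB n (f * (X n i)⁻¹)).Finite :=
    Set.Finite.of_finite_image (hfin2.subset hmap.image_subset) hinj.injOn
  refine ⟨hfin3, ?_⟩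
  have := Set.ncard_le_ncard_of_injOn τ hmap hinj.injOn hfin2
  have h2 := Set.ncard_sdiff_singleton_add_one hi hfin
  omega

theorem step_inv {f : Circle ≃ₜ Circle} (i : ℕ) (hi : (0, i) ∈ NB n f) :
    NB n (f * (X n i)⁻¹)⁻¹ ⊆ NB n f⁻¹ := by
  intro J hJ
  rintro ⟨I, hI⟩
  apply hJ
  have hne : I ≠ (0, i) := by
    rintro rfl
    have := MM_inv n hI
    rw [inv_inv] at this
    exact hi ⟨_, this⟩
  obtain ⟨K, hK⟩ := X_fwd n i I hne
  rw [mul_inv_rev, inv_inv]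
  exact ⟨K, MM_comp n hI hK⟩

theorem lemA (Q : ℕ) : ∀ (r : ℕ) (f : Circle ≃ₜ Circle) (q B : ℕ), (NB n f).Finite →
    (NB n f).ncard ≤ r → B + r = Q → q ≤ Q →
    (∀ i, (0, i) ∈ NB n f → q ≤ (i - 1) / (n - 1)) →
    (∀ m, B * (n - 1) ≤ m → (0, m) ∉ NB n f) →
    ∃ P : Circle ≃ₜ Circle, HasLen (XS n) (P * X n 0 ^ q) (r + (Q - q) + Q) ∧
      NB n (f * P⁻¹) = ∅ ∧ NB n (f * P⁻¹)⁻¹ ⊆ NB n f⁻¹ := by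
  have h2 := hn.out
  have hX0 : X n 0 ∈ XS n := ⟨0, by omega, rfl⟩
  intro r
  induction r with
  | zero =>
    intro f q B hfin hr hB hq _ _
    have : NB n f = ∅ := by
      rw [← Set.ncard_eq_zero hfin]; omega
    refine ⟨1, ?_, by simpa using this, by simp⟩
    rw [one_mul]
    exact (HasLen.pow hX0 q).mono (by omega)
  | succ r ih =>
    intro f q B hfin hr hB hq hlow hhigh
    by_cases he : ∀ i, (0, i) ∉ NB n f
    · refine ⟨1, ?_, by simpa using NB_empty_of n he, by simp⟩
      rw [one_mul]
      exact (HasLen.pow hX0 q).mono (by omega)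
    push Not at he
    classical
    set i := Nat.find he with hidef
    have hi : (0, i) ∈ NB n f := Nat.find_spec he
    have hmin : ∀ j < i, (0, j) ∉ NB n f := fun j hj => Nat.find_min he hj
    have hiB : i < B * (n - 1) := by
      by_contra hc
      exact hhigh i (by omega) hi
    obtain ⟨hfin', hcard⟩ := step_card n hfin i hi
    set q' := (i - 1) / (n - 1) with hq'
    have hq'B : q' < B := by
      rw [hq', Nat.div_lt_iff_lt_mul (by omega)]; omega
    have hqq : q ≤ q' := hlow i hi
    obtain ⟨P, hP1, hP2, hP3⟩ := ih (f * (X n i)⁻¹) q' (B + 1) hfin' (by omega) (by omega) (by omega)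
      (by
        intro j hj
        apply Nat.div_le_div_right
        have : i ≤ j := by
          by_contra hc
          have hj2 := hmin j (by omega)
          apply hj
          simp only [NB, Set.mem_ofPred_eq, not_not] at hj2
          obtain ⟨K, hK⟩ := hj2
          exact ⟨K, MM_comp n (MM_inv n (XM1 n i 0 j (by simp; omega))) hK⟩
        omega)
      (by
        intro m hm hb
        rw [add_mul, one_mul] at hm
        obtain ⟨m', rfl⟩ := Nat.exists_eq_add_of_le' (show n - 1 ≤ m by omega)
        have hg := hhigh m' (by omega)
        simp only [NB, Set.mem_ofPred_eq, not_not] at hg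
        obtain ⟨K, hK⟩ := hg
        have h3 := XM3 n i 0 m' (by simp; omega)
        simp only [pow_zero, mul_one] at h3
        exact hb ⟨K, MM_comp n (MM_inv n h3) hK⟩)
    obtain ⟨ρ, hρ, hXi⟩ := X_form n i
    rw [← hq'] at hXi
    refine ⟨P * X n i, ?_, ?_, ?_⟩
    · obtain ⟨d, hd⟩ := Nat.exists_eq_add_of_le hqq
      have e : P * X n i * X n 0 ^ q = P * X n 0 ^ q' * X n ρ * (X n 0 ^ d)⁻¹ := by
        rw [hXi]
        nth_rewrite 2 [hd]
        rw [pow_add]; group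
      rw [e]
      refine ((hP1.mul (HasLen.gen ⟨ρ, hρ, rfl⟩)).mul (HasLen.pow hX0 d).inv).mono (by omega)
    · rw [mul_inv_rev, ← mul_assoc]; exact hP2
    · have e : f * (P * X n i)⁻¹ = f * (X n i)⁻¹ * P⁻¹ := by rw [mul_inv_rev, ← mul_assoc]
      rw [e]
      exact hP3.trans (step_inv n i hi)

end algo

set_option linter.unusedSectionVars false
section bound
variable (n : ℕ) [hn : Fact (2 ≤ n)]

theorem MM_uniq {f : Circle ≃ₜ Circle} {I J J' : ℕ × ℕ} (h : MM n f I J) (h' : MM n f I J') : J = J' :=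
  MM_inj n (MM_inv n h) (MM_inv n h')

theorem eq_one_of {h : Circle ≃ₜ Circle} (h0 : h ((0:ℝ) : Circle) = ((0:ℝ) : Circle))
    (h1 : NB n h = ∅) (h2 : NB n h⁻¹ = ∅) : h = 1 := by
  have hn0 := n_pos n
  have g1 : ∀ I, ∃ J, MM n h I J := by
    intro I
    by_contra hc
    have : I ∈ NB n h := hc
    rw [h1] at this; exact this
  have g2 : ∀ I, ∃ J, MM n h⁻¹ I J := by
    intro I
    by_contra hc
    have : I ∈ NB n h⁻¹ := hc
    rw [h2] at this; exact this
  have g3 : ∀ j : ℕ, ∃ s : ℕ, MM n h (0, j) (0, s) := by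
    intro j
    obtain ⟨⟨k, m⟩, hk⟩ := g1 (0, j)
    obtain ⟨⟨l, p⟩, hl⟩ := g2 (0, m / n ^ k)
    have hp : 0 < n ^ k := pow_pos (by have := hn.out; omega) _
    have h3 := MM_sub n hl k (m % n ^ k) (Nat.mod_lt _ hp)
    simp only [zero_add, Nat.div_add_mod'] at h3
    have h4 := MM_uniq n (MM_inv n hk) h3
    have h5 := congrArg Prod.fst h4
    simp only at h5
    have : k = 0 := by omega
    subst this
    exact ⟨m, hk⟩
  choose σ hσ using g3
  have key : ∀ j : ℕ, ∀ t : ℝ, 0 ≤ t → t ≤ 1 → h (psi n (j + t)) = psi n (σ j + t) := by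
    intro j t ht0 ht1
    have := hσ j t ht0 ht1
    simpa using this
  have hs : ∀ j : ℕ, σ j = j := by
    intro j
    induction j with
    | zero =>
      have h3 := key 0 0 le_rfl zero_le_one
      simp only [Nat.cast_zero, add_zero] at h3
      rw [psi_zero, h0, ← psi_zero n] at h3
      have := psi_inj n _ _ le_rfl (by positivity) h3
      exact_mod_cast this.symm
    | succ j ih =>
      have h3 := key (j + 1) 0 le_rfl zero_le_one
      have h4 := key j 1 zero_le_one le_rfl
      push_cast at h3
      rw [add_zero, add_zero, h4] at h3
      have := psi_inj n _ _ (by positivity) (by positivity) h3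
      rw [ih] at this
      exact_mod_cast this.symm
  ext p
  obtain ⟨y, hy, rfl⟩ := psi_surj n p
  have h3 := key ⌊y⌋₊ (y - ⌊y⌋₊) (by linarith [Nat.floor_le hy]) (by linarith [Nat.lt_floor_add_one y])
  rw [hs, add_sub_cancel] at h3
  exact h3

theorem X_fix (i : ℕ) : X n i ((0:ℝ) : Circle) = ((0:ℝ) : Circle) := by
  have := X_1 n i 0 le_rfl (by positivity)
  rwa [psi_zero] at this

theorem hasLen_fix {g : Circle ≃ₜ Circle} {k : ℕ} (h : HasLen (XS n) g k) :
    g ((0:ℝ) : Circle) = ((0:ℝ) : Circle) := by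
  have h1 := h.mem_closure
  clear h
  induction h1 using Subgroup.closure_induction with
  | mem x hx => obtain ⟨i, _, rfl⟩ := hx; exact X_fix n i
  | one => rfl
  | mul x y hx hy ihx ihy =>
    rw [hmul_apply, ihy, ihx]
  | inv x hx ihx =>
    nth_rewrite 1 [← ihx]
    exact hinv_apply_self x _

theorem NB_fin {f : Circle ≃ₜ Circle} (h0 : f ((0:ℝ) : Circle) = ((0:ℝ) : Circle))
    (hfin : (Bad n f).Finite) : (NB n f).Finite ∧ (SB n f).Finite ∧
      (NB n f).ncard + (SB n f).ncard ≤ (Bad n f).ncard := by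
  have h := NB_add_SB n h0
  rw [← hfin.cast_ncard_eq] at h
  have h1 : (NB n f).Finite := by
    rw [← Set.encard_lt_top_iff]
    exact (le_self_add.trans h).trans_lt (WithTop.coe_lt_top _)
  have h2 : (SB n f).Finite := by
    rw [← Set.encard_lt_top_iff]
    exact (le_add_self.trans h).trans_lt (WithTop.coe_lt_top _)
  rw [← h1.cast_ncard_eq, ← h2.cast_ncard_eq] at h
  exact ⟨h1, h2, by exact_mod_cast h⟩

theorem hinv_fix {f : Circle ≃ₜ Circle} (h0 : f ((0:ℝ) : Circle) = ((0:ℝ) : Circle)) :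
    f⁻¹ ((0:ℝ) : Circle) = ((0:ℝ) : Circle) := by
  nth_rewrite 1 [← h0]
  exact hinv_apply_self f _

theorem lenF {f : Circle ≃ₜ Circle} (h0 : f ((0:ℝ) : Circle) = ((0:ℝ) : Circle))
    (hfin : (Bad n f).Finite) :
    HasLen (XS n) f (3 * (Bad n f).ncard + 3 * (Bad n f⁻¹).ncard) := by
  have hfin' := Bad_inv n hfin
  have h0' := hinv_fix h0
  obtain ⟨a1, a2, a3⟩ := NB_fin n h0 hfin
  obtain ⟨b1, b2, b3⟩ := NB_fin n h0' hfin'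
  obtain ⟨P, hP1, hP2, hP3⟩ := lemA n ((SB n f).ncard + (NB n f).ncard) (NB n f).ncard f 0
    (SB n f).ncard a1 le_rfl rfl (Nat.zero_le _) (fun _ _ => Nat.zero_le _)
    (fun m hm => spine_bound n h0 a2 m hm)
  have hPlen : HasLen (XS n) P (3 * (Bad n f).ncard) := by
    rw [pow_zero, mul_one] at hP1
    exact hP1.mono (by omega)
  obtain ⟨R, hR1, hR2, hR3⟩ := lemA n ((SB n f⁻¹).ncard + (NB n f⁻¹).ncard) (NB n f⁻¹).ncard
    (f * P⁻¹)⁻¹ 0 (SB n f⁻¹).ncard (b1.subset hP3) (Set.ncard_le_ncard hP3 b1) rfl (Nat.zero_le _)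
    (fun _ _ => Nat.zero_le _) (fun m hm hb => spine_bound n h0' b2 m hm (hP3 hb))
  have hRlen : HasLen (XS n) R (3 * (Bad n f⁻¹).ncard) := by
    rw [pow_zero, mul_one] at hR1
    exact hR1.mono (by omega)
  rw [inv_inv, hP2] at hR3
  have hone := eq_one_of n (h := (f * P⁻¹)⁻¹ * R⁻¹) (by
    rw [mul_inv_rev, inv_inv, hmul_apply, hmul_apply, hinv_fix (hasLen_fix n hRlen), h0',
      hasLen_fix n hPlen]) hR2 (Set.subset_empty_iff.1 hR3)
  have : f = R⁻¹ * P := by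
    rw [mul_inv_rev, inv_inv, mul_inv_eq_one, mul_inv_eq_iff_eq_mul] at hone
    rw [hone]; simp
  rw [this]
  refine (hRlen.inv.mul hPlen).mono ?_
  rw [← this]; omega

end bound

set_option linter.unusedSectionVars false
section counts
variable (n : ℕ) [hn : Fact (2 ≤ n)]

theorem nonspine_good {f : Circle ≃ₜ Circle} {A I : ℕ × ℕ}
    (hI : ∀ t : ℝ, 0 ≤ t → t ≤ 1 → phi n (((I.2:ℝ) + t) / (n:ℝ) ^ I.1) = ((A.2:ℝ) + t) / (n:ℝ) ^ A.1)
    (h : ∃ J, MM n f I J) : ∃ B : ℕ × ℕ, B.2 < n ^ B.1 ∧ TM n f A B := by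
  obtain ⟨J, hJ⟩ := h
  obtain ⟨B, hB, hB2⟩ := toT n J
  refine ⟨B, by omega, ?_⟩
  intro t h0 h1
  have := hJ t h0 h1
  unfold psi at this
  rw [hI t h0 h1, hB2 t h0 h1] at this
  exact this

theorem spine_X (i k : ℕ) (hk : i + 1 ≤ k * (n - 1)) :
    TM n (X n i) (k, n ^ k - 1) (k + 1, n ^ (k + 1) - 1) := by
  have hn0 := n_pos n
  have hpos : ∀ j : ℕ, 1 ≤ n ^ j := fun j => Nat.one_le_pow _ _ (by have := hn.out; omega)
  have e : ∀ (j : ℕ) (t : ℝ), (((n ^ j - 1 : ℕ) : ℝ) + t) / (n:ℝ) ^ j = 1 - (1 - t) / (n:ℝ) ^ j := by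
    intro j t
    have hp : (0:ℝ) < (n:ℝ) ^ j := by positivity
    rw [Nat.cast_sub (hpos j)]
    push_cast
    field_simp
    ring
  intro t h0 h1
  simp only
  rw [e, e]
  rcases h1.lt_or_eq with h1 | rfl
  · obtain ⟨y, hy, h⟩ := phi_surj n t h0 h1
    rw [← h, ← phi_shift_k n k y hy, ← phi_shift_k n (k + 1) y hy]
    have := X_3 n i (y + k * ((n:ℝ) - 1)) (by
      rw [← cast_sub_one]
      have : ((i + 1 : ℕ):ℝ) ≤ ((k * (n - 1) : ℕ) : ℝ) := by exact_mod_cast hk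
      push_cast at this ⊢
      linarith)
    unfold psi at this
    rw [this]
    congr 2
    push_cast; ring
  · simp only [sub_self, zero_div, sub_zero]
    rw [coe_one', X_fix]

theorem Bad_X (i : ℕ) (hi : i < n) : (Bad n (X n i)).encard ≤ 3 := by
  have h2 := hn.out
  have hn0 := n_pos n
  obtain ⟨A, hA, hA2⟩ := toT n (0, i)
  have hsub : Bad n (X n i) ⊆ {A, (0, 0), (1, n - 1)} := by
    rintro ⟨k, a⟩ ⟨ha, hb⟩
    simp only at ha
    rcases lt_or_eq_of_le (Nat.succ_le_of_lt ha) with h | h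
    · obtain ⟨I, hI⟩ := fromT n k a h
      by_cases hIi : I = (0, i)
      · subst hIi
        left
        apply real_unique n
        · have e1 := hI 0 le_rfl zero_le_one
          have e2 := hA2 0 le_rfl zero_le_one
          rw [e1] at e2
          simpa using e2
        · have e1 := hI (1 / 2) (by norm_num) (by norm_num)
          have e2 := hA2 (1 / 2) (by norm_num) (by norm_num)
          rw [e1] at e2
          exact e2
      · exact absurd (nonspine_good n (A := (k, a)) hI (X_fwd n i I hIi)) hb
    · right
      have ha' : a = n ^ k - 1 := by omega
      subst ha'
      rcases k with _ | _ | k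
      · left; simp
      · right; simp
      · exfalso
        apply hb
        refine ⟨_, ?_, spine_X n i (k + 1 + 1) ?_⟩
        · have := Nat.one_le_pow (k + 1 + 1 + 1) n (by omega)
          simp only; omega
        · have : 2 * (n - 1) ≤ (k + 1 + 1) * (n - 1) := Nat.mul_le_mul_right _ (by omega)
          omega
  refine (Set.encard_le_encard hsub).trans ?_
  refine (Set.encard_insert_le _ _).trans ?_
  have := Set.encard_insert_le ({(1, n - 1)} : Set (ℕ × ℕ)) (0, 0)
  rw [Set.encard_singleton] at this
  calc _ ≤ (1 + 1 + 1 : ℕ∞) := by gcongr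
    _ = 3 := by norm_num

theorem Bad_Xinv (i : ℕ) (hi : i < n) : (Bad n (X n i)⁻¹).encard ≤ 3 := by
  have h2 := hn.out
  have hn0 := n_pos n
  have hsub : Bad n (X n i)⁻¹ ⊆ {(0, 0), (1, n - 1), (2, n ^ 2 - 1)} := by
    rintro ⟨k, a⟩ ⟨ha, hb⟩
    simp only at ha
    rcases lt_or_eq_of_le (Nat.succ_le_of_lt ha) with h | h
    · obtain ⟨I, hI⟩ := fromT n k a h
      obtain ⟨J, _, hJ⟩ := X_bwd n i I
      exact absurd (nonspine_good n (A := (k, a)) hI ⟨J, MM_inv n hJ⟩) hb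
    · have ha' : a = n ^ k - 1 := by omega
      subst ha'
      rcases k with _ | _ | _ | k
      · left; simp
      · right; left; simp
      · right; right; simp
      · exfalso
        apply hb
        refine ⟨_, ?_, TM_inv n (spine_X n i (k + 1 + 1) ?_)⟩
        · have := Nat.one_le_pow (k + 1 + 1) n (by omega)
          simp only; omega
        · have : 2 * (n - 1) ≤ (k + 1 + 1) * (n - 1) := Nat.mul_le_mul_right _ (by omega)
          omega
  refine (Set.encard_le_encard hsub).trans ?_
  refine (Set.encard_insert_le _ _).trans ?_
  have := Set.encard_insert_le ({(2, n ^ 2 - 1)} : Set (ℕ × ℕ)) (1, n - 1)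
  rw [Set.encard_singleton] at this
  calc _ ≤ (1 + 1 + 1 : ℕ∞) := by gcongr
    _ = 3 := by norm_num

theorem Bad_rotlike {f : Circle ≃ₜ Circle} (c : ℕ)
    (hf : ∀ x : ℝ, f (x : Circle) = ((x + c / n : ℝ) : Circle)) : (Bad n f).encard ≤ 3 := by
  have h2 := hn.out
  have hn0 := n_pos n
  have hsub : Bad n f ⊆ {(0, 0)} := by
    rintro ⟨k, a⟩ ⟨ha, hb⟩
    simp only at ha
    rcases k with _ | k
    · simp at ha; simp [ha]
    · exfalso
      apply hb
      have hp : 0 < n ^ (k + 1) := pow_pos (by omega) _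
      refine ⟨(k + 1, (a + c * n ^ k) % n ^ (k + 1)), Nat.mod_lt _ hp, ?_⟩
      intro t h0 h1
      rw [hf]
      simp only
      have e : ((a + c * n ^ k : ℕ) : ℝ) = (((a + c * n ^ k) % n ^ (k + 1) : ℕ) : ℝ)
          + ((a + c * n ^ k) / n ^ (k + 1) : ℕ) * (n:ℝ) ^ (k + 1) := by
        exact_mod_cast (Nat.mod_add_div' (a + c * n ^ k) (n ^ (k + 1))).symm
      have e2 : ((a:ℝ) + t) / (n:ℝ) ^ (k + 1) + c / n
          = ((((a + c * n ^ k) % n ^ (k + 1) : ℕ) : ℝ) + t) / (n:ℝ) ^ (k + 1)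
            + (((a + c * n ^ k) / n ^ (k + 1) : ℕ) : ℤ) := by
        have e3 : ((a:ℝ) + t) / (n:ℝ) ^ (k + 1) + c / n
          = (((a + c * n ^ k : ℕ) : ℝ) + t) / (n:ℝ) ^ (k + 1) := by
          push_cast; field_simp; ring
        rw [e3, e, Int.cast_natCast]
        have hp' : (0:ℝ) < (n:ℝ) ^ (k + 1) := by positivity
        field_simp
        ring
      rw [e2, coe_add_int]
  refine (Set.encard_le_encard hsub).trans ?_
  rw [Set.encard_singleton]; norm_num

theorem Bad_rot : (Bad n (rot n)).encard ≤ 3 := by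
  apply Bad_rotlike n 1
  intro x
  rw [rot_apply]; simp

theorem Bad_rotinv : (Bad n (rot n)⁻¹).encard ≤ 3 := by
  have hn0 := n_pos n
  apply Bad_rotlike n (n - 1)
  intro x
  have h : (rot n)⁻¹ (x : Circle) = ((x - 1 / n : ℝ) : Circle) := rot_symm_apply n x
  rw [h, cast_sub_one]
  have : x + ((n:ℝ) - 1) / n = x - 1 / n + (1 : ℤ) := by push_cast; field_simp; ring
  rw [this, coe_add_int]

/-- The generators of `T_n`. -/
def TS (n : ℕ) [Fact (2 ≤ n)] : Set (Circle ≃ₜ Circle) := XS n ∪ {rot n}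

theorem Bad_TS {g : Circle ≃ₜ Circle} (h : g ∈ TS n ∨ g⁻¹ ∈ TS n) : (Bad n g).encard ≤ 3 := by
  rcases h with (⟨i, hi, rfl⟩ | rfl) | (⟨i, hi, h⟩ | h)
  · exact Bad_X n i hi
  · exact Bad_rot n
  · rw [← inv_inv g, h]; exact Bad_Xinv n i hi
  · rw [← inv_inv g, show g⁻¹ = rot n from h]; exact Bad_rotinv n

theorem Bad_one : Bad n 1 = ∅ := by
  ext I
  simp only [Set.mem_empty_iff_false, iff_false]
  rintro ⟨hI, h⟩
  exact h ⟨I, hI, fun t _ _ => rfl⟩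

theorem Bad_word {g : Circle ≃ₜ Circle} {k : ℕ} (h : HasLen (TS n) g k) :
    (Bad n g).encard ≤ (3 * k : ℕ) := by
  obtain ⟨w, h1, h2, rfl⟩ := h
  have key : (Bad n w.prod).encard ≤ (3 * w.length : ℕ) := by
    clear h1
    induction w with
    | nil => simp [Bad_one]
    | cons a w ih =>
      rw [List.prod_cons]
      refine (Bad_mul n _ _).trans ?_
      have i1 := ih (fun x hx => h2 x (List.mem_cons_of_mem _ hx))
      have i2 := Bad_TS n (h2 a List.mem_cons_self)
      refine (add_le_add i1 i2).trans ?_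
      rw [List.length_cons, mul_add]
      push_cast
      norm_num
  exact key.trans (by exact_mod_cast (by omega))

theorem len_compare {g : Circle ≃ₜ Circle} (h0 : g ((0:ℝ) : Circle) = ((0:ℝ) : Circle)) {k : ℕ}
    (h : HasLen (TS n) g k) : HasLen (XS n) g (18 * k) := by
  have h1 := Bad_word n h
  have h2 := Bad_word n h.inv
  have f1 : (Bad n g).Finite := Set.finite_of_encard_le_coe h1
  have f2 := Bad_inv n f1
  rw [← f1.cast_ncard_eq] at h1
  rw [← f2.cast_ncard_eq] at h2
  have h1' : (Bad n g).ncard ≤ 3 * k := by exact_mod_cast h1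
  have h2' : (Bad n g⁻¹).ncard ≤ 3 * k := by exact_mod_cast h2
  exact (lenF n h0 f1).mono (by omega)

end counts

set_option linter.unusedSectionVars false
section final
variable (n : ℕ) [hn : Fact (2 ≤ n)]

theorem X_mem_TS (i : ℕ) : X n i ∈ Subgroup.closure (TS n) := by
  have h2 := hn.out
  have hb : ∀ j < n, X n j ∈ Subgroup.closure (TS n) := fun j hj =>
    Subgroup.subset_closure (Or.inl ⟨j, hj, rfl⟩)
  obtain ⟨ρ, hρ, h⟩ := X_form n i
  rw [h]
  have h0 := Subgroup.pow_mem _ (hb 0 (by omega)) ((i - 1) / (n - 1))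
  exact Subgroup.mul_mem _ (Subgroup.mul_mem _ h0 (hb ρ hρ)) (Subgroup.inv_mem _ h0)

theorem rot_pow_zero (j : ℕ) : (rot n ^ j) ((0:ℝ) : Circle) = ((j / n : ℝ) : Circle) := by
  induction j with
  | zero => simp
  | succ j ih =>
    rw [pow_succ', hmul_apply, ih, rot_apply]
    congr 1; push_cast; ring

theorem red_int (m : ℕ) : ∃ u ∈ Subgroup.closure (TS n), u (psi n m) = ((0:ℝ) : Circle) := by
  have h2 := hn.out
  induction m using Nat.strong_induction_on with
  | _ m ih =>
    rcases le_or_gt m (n - 1) with h | h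
    · have h' : (m:ℝ) ≤ (n:ℝ) - 1 := by
        rw [← cast_sub_one]; exact_mod_cast h
      refine ⟨(rot n ^ m)⁻¹, Subgroup.inv_mem _ (Subgroup.pow_mem _
        (Subgroup.subset_closure (show rot n ∈ TS n from Or.inr rfl)) _), ?_⟩
      rw [psi, phi_base n m (by positivity) h', ← rot_pow_zero]
      exact hinv_apply_self _ _
    · obtain ⟨m', rfl⟩ := Nat.exists_eq_add_of_le' h.le
      obtain ⟨u, hu, hu2⟩ := ih m' (by omega)
      refine ⟨u * (X n 0)⁻¹, Subgroup.mul_mem _ hu (Subgroup.inv_mem _ (X_mem_TS n 0)), ?_⟩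
      have hx := X_3 n 0 m' (by
        have : 1 ≤ m' := by omega
        push_cast; simpa using this)
      rw [Nat.cast_add, cast_sub_one, ← hx, hmul_apply, hinv_apply_self, hu2]

theorem red (k : ℕ) : ∀ m : ℕ, ∃ u ∈ Subgroup.closure (TS n),
    u (psi n ((m:ℝ) / (n:ℝ) ^ k)) = ((0:ℝ) : Circle) := by
  have h2 := hn.out
  have hn0 := n_pos n
  induction k with
  | zero => intro m; simpa using red_int n m
  | succ k ih =>
    intro m
    have hp : 0 < n ^ (k + 1) := pow_pos (by omega) _
    have hp' : (0:ℝ) < (n:ℝ) ^ (k + 1) := by positivity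
    set i := m / n ^ (k + 1) with hi
    set c := m % n ^ (k + 1) with hc
    have hm : (m:ℝ) = i * (n:ℝ) ^ (k + 1) + c := by
      exact_mod_cast (Nat.div_add_mod' m (n ^ (k + 1))).symm
    have hc1 : (c:ℝ) ≤ (n:ℝ) ^ (k + 1) := by exact_mod_cast (Nat.mod_lt m hp).le
    have hx := X_2 n i ((c:ℝ) / (n:ℝ) ^ (k + 1)) (by positivity) (by rw [div_le_one hp']; exact hc1)
    obtain ⟨u, hu, hu2⟩ := ih (i * n ^ k + c)
    refine ⟨u * X n i, Subgroup.mul_mem _ hu (X_mem_TS n i), ?_⟩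
    have e1 : (m:ℝ) / (n:ℝ) ^ (k + 1) = i + (c:ℝ) / (n:ℝ) ^ (k + 1) := by
      rw [hm]; field_simp
    have e2 : (i:ℝ) + n * ((c:ℝ) / (n:ℝ) ^ (k + 1)) = ((i * n ^ k + c : ℕ) : ℝ) / (n:ℝ) ^ k := by
      push_cast; field_simp; ring
    rw [hmul_apply, e1, hx, e2, hu2]

theorem TS_le : Subgroup.closure (TS n) ≤ Tn n := by
  rw [Subgroup.closure_le]
  rintro g (⟨i, _, rfl⟩ | rfl)
  · exact Subgroup.subset_closure (X_inT n i)
  · exact Subgroup.subset_closure (rot_inT n)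

theorem Fix_gen (g : Circle ≃ₜ Circle) (hg : g ∈ Tn n) (h0 : g ((0:ℝ) : Circle) = ((0:ℝ) : Circle)) :
    ∃ k, HasLen (XS n) g k := ⟨_, lenF n h0 (Bad_finite_Tn n g hg)⟩

theorem Tn_gen (g : Circle ≃ₜ Circle) (hg : g ∈ Tn n) : g ∈ Subgroup.closure (TS n) := by
  have h2 := hn.out
  have hn0 := n_pos n
  obtain ⟨K, hK⟩ := exists_good n (Bad_finite_Tn n g hg)
  obtain ⟨⟨l, b⟩, hb, hT⟩ := hK 0 (pow_pos (by omega) _)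
  simp only at hb
  have hlt : b * n + 1 < n ^ (l + 1) := by
    have : (b + 1) * n ≤ n ^ l * n := Nat.mul_le_mul_right _ hb
    rw [pow_succ]; rw [add_mul] at this; omega
  obtain ⟨⟨k, m⟩, hI⟩ := fromT n (l + 1) (b * n) hlt
  have e1 := hT 0 le_rfl zero_le_one
  have e2 := hI 0 le_rfl zero_le_one
  simp only [add_zero, Nat.cast_zero, zero_div] at e1 e2
  have e3 : ((b * n : ℕ) : ℝ) / (n:ℝ) ^ (l + 1) = (b:ℝ) / (n:ℝ) ^ l := by
    push_cast; field_simp; ring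
  rw [e3] at e2
  obtain ⟨u, hu, hu2⟩ := red n k m
  rw [psi, e2, ← e1] at hu2
  obtain ⟨j, hj⟩ := Fix_gen n (u * g) (Subgroup.mul_mem _ (TS_le n hu) hg) hu2
  have hj2 := (hj.subset (Set.subset_union_left : XS n ⊆ TS n)).mem_closure
  have := Subgroup.mul_mem _ (Subgroup.inv_mem _ hu) hj2
  simpa using this

/-- The generator `X n i` as an element of `Fix0 n`. -/
def XF (i : ℕ) : Fix0 n := ⟨⟨X n i, Subgroup.subset_closure (X_inT n i)⟩, X_fix n i⟩

/-- The rotation as an element of `Tn n`. -/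
def RT : Tn n := ⟨rot n, Subgroup.subset_closure (rot_inT n)⟩

theorem X_injective : Function.Injective (X n) := by
  have hn2 := n_ge n
  have key : ∀ i j : ℕ, i < j → X n i ≠ X n j := by
    intro i j hij h
    have hc : (i:ℝ) + 1 ≤ j := by exact_mod_cast hij
    have h1 := X_3 n i (i + 1) le_rfl
    rw [h, X_1 n j _ (by positivity) hc] at h1
    have := psi_inj n _ _ (by positivity) (by have : (0:ℝ) ≤ i := by positivity
                                              linarith) h1
    linarith
  intro i j h
  rcases lt_trichotomy i j with h1 | h1 | h1
  · exact absurd h (key i j h1)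
  · exact h1
  · exact absurd h.symm (key j i h1)

theorem rot_move : rot n ((0:ℝ) : Circle) ≠ ((0:ℝ) : Circle) := by
  have hn0 := n_pos n
  have hn2 := n_ge n
  rw [rot_apply, zero_add]
  intro h
  have h3 : (1:ℝ) / n < 1 := by rw [div_lt_one hn0]; linarith
  have := coe_inj _ _ (by positivity) h3 le_rfl one_pos h
  have : (0:ℝ) < 1 / n := by positivity
  linarith

end final

/-- Let `n ≥ 2` and let `H` be the subgroup of `T_n` of elements
fixing the point `0` (a copy of `F_n` inside `T_n`).  There exist a finite generating set
`Σ_n` of `H` with `n` elements and a finite generating set `Σ` of `T_n` with `n+1`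
elements such that for every nontrivial `ω ∈ H`,
`|ω|_{Σ_n}/(36(n-1)) ≤ |ω|_Σ ≤ 45(n-1)²·|ω|_{Σ_n} - 1`. -/
theorem word_length_comparison_Fn_Tn (n : ℕ) (hn : 2 ≤ n) :
    ∃ Sn : Finset (Fix0 n), Sn.card = n ∧
      Subgroup.closure (Sn : Set (Fix0 n)) = ⊤ ∧
    ∃ S : Finset (Tn n), S.card = n + 1 ∧
      Subgroup.closure (S : Set (Tn n)) = ⊤ ∧
      ∀ ω : Fix0 n, ω ≠ 1 →
        (wordLength (Sn : Set (Fix0 n)) ω : ℝ) / (36 * ((n : ℝ) - 1)) ≤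
            (wordLength (S : Set (Tn n)) (ω : Tn n) : ℝ) ∧
        (wordLength (S : Set (Tn n)) (ω : Tn n) : ℝ) ≤
            45 * ((n : ℝ) - 1) ^ 2 * (wordLength (Sn : Set (Fix0 n)) ω : ℝ) - 1 := by
  classical
  have hF : Fact (2 ≤ n) := ⟨hn⟩
  have hn2 := n_ge n
  have hXT : Function.Injective (fun i => ((XF n i : Fix0 n) : Tn n)) := by
    intro i j h
    exact X_injective n (congrArg Subtype.val h)
  have hXF : Function.Injective (XF n) := by
    intro i j h
    exact hXT (congrArg Subtype.val h)
  set Sn : Finset (Fix0 n) := (Finset.range n).image (XF n) with hSn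
  set S : Finset (Tn n) := insert (RT n) ((Finset.range n).image (fun i => ((XF n i : Fix0 n) : Tn n)))
    with hS
  set j1 : Fix0 n →* Tn n := (Fix0 n).subtype with hj1
  set j2 : Tn n →* (Circle ≃ₜ Circle) := (Tn n).subtype with hj2
  have inj1 : Function.Injective j1 := Subtype.val_injective
  have inj2 : Function.Injective j2 := Subtype.val_injective
  have im1 : (j2.comp j1) '' (Sn : Set (Fix0 n)) = XS n := by
    ext g
    constructor
    · rintro ⟨x, hx, rfl⟩
      obtain ⟨i, hi, rfl⟩ := Finset.mem_image.1 (Finset.mem_coe.1 hx)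
      exact ⟨i, Finset.mem_range.1 hi, rfl⟩
    · rintro ⟨i, hi, rfl⟩
      exact ⟨XF n i, Finset.mem_coe.2 (Finset.mem_image.2 ⟨i, Finset.mem_range.2 hi, rfl⟩), rfl⟩
  have im2 : j2 '' (S : Set (Tn n)) = TS n := by
    ext g
    constructor
    · rintro ⟨x, hx, rfl⟩
      rcases Finset.mem_insert.1 (Finset.mem_coe.1 hx) with rfl | hx
      · exact Or.inr rfl
      · obtain ⟨i, hi, rfl⟩ := Finset.mem_image.1 hx
        exact Or.inl ⟨i, Finset.mem_range.1 hi, rfl⟩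
    · rintro (⟨i, hi, rfl⟩ | rfl)
      · exact ⟨((XF n i : Fix0 n) : Tn n), Finset.mem_coe.2 (Finset.mem_insert_of_mem
          (Finset.mem_image.2 ⟨i, Finset.mem_range.2 hi, rfl⟩)), rfl⟩
      · exact ⟨RT n, Finset.mem_coe.2 (Finset.mem_insert_self _ _), rfl⟩
  have sub1 : j1 '' (Sn : Set (Fix0 n)) ⊆ (S : Set (Tn n)) := by
    rintro _ ⟨x, hx, rfl⟩
    obtain ⟨i, hi, rfl⟩ := Finset.mem_image.1 (Finset.mem_coe.1 hx)
    exact Finset.mem_coe.2 (Finset.mem_insert_of_mem (Finset.mem_image.2 ⟨i, hi, rfl⟩))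
  have inj12 : Function.Injective (j2.comp j1) := inj2.comp inj1
  have gen1 : Subgroup.closure (Sn : Set (Fix0 n)) = ⊤ := by
    rw [eq_top_iff]
    intro g _
    obtain ⟨k, hk⟩ := Fix_gen n (j2 (j1 g)) (j1 g).2 g.2
    rw [← im1] at hk
    exact (HasLen.comap (j2.comp j1) inj12 hk).mem_closure
  have gen2 : Subgroup.closure (S : Set (Tn n)) = ⊤ := by
    rw [eq_top_iff]
    intro g _
    obtain ⟨k, hk⟩ := exists_hasLen (Tn_gen n (j2 g) g.2)
    rw [← im2] at hk
    exact (HasLen.comap j2 inj2 hk).mem_closure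
  refine ⟨Sn, ?_, gen1, S, ?_, gen2, ?_⟩
  · rw [hSn, Finset.card_image_of_injective _ hXF, Finset.card_range]
  · rw [hS, Finset.card_insert_of_notMem, Finset.card_image_of_injective _ hXT, Finset.card_range]
    intro hc
    obtain ⟨i, hi, h⟩ := Finset.mem_image.1 hc
    have h' : X n i = rot n := congrArg Subtype.val h
    exact rot_move n (h' ▸ X_fix n i)
  · intro ω hω
    have l1 : HasLen (Sn : Set (Fix0 n)) ω (wordLength (Sn : Set (Fix0 n)) ω) :=
      hasLen_wordLength (by rw [gen1]; trivial)
    have l2 : HasLen (S : Set (Tn n)) (ω : Tn n) (wordLength (S : Set (Tn n)) (ω : Tn n)) :=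
      hasLen_wordLength (by rw [gen2]; trivial)
    set a := wordLength (Sn : Set (Fix0 n)) ω with ha
    set b := wordLength (S : Set (Tn n)) (ω : Tn n) with hb
    have hba : b ≤ a := ((l1.map j1).subset sub1).wordLength_le
    have hab : a ≤ 18 * b := by
      have h1 := l2.map j2
      rw [im2] at h1
      have h2 := len_compare n ω.2 h1
      rw [← im1] at h2
      exact (HasLen.comap (j2.comp j1) inj12 h2).wordLength_le
    have ha1 : 1 ≤ a := by
      by_contra hc
      have h0 : a = 0 := by omega
      obtain ⟨w, hw1, _, hw3⟩ := l1
      rw [h0] at hw1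
      have : w = [] := List.eq_nil_of_length_eq_zero (by omega)
      subst this
      exact hω (by rw [← hw3]; rfl)
    have hba' : (b:ℝ) ≤ a := by exact_mod_cast hba
    have hab' : (a:ℝ) ≤ 18 * b := by exact_mod_cast hab
    have ha1' : (1:ℝ) ≤ a := by exact_mod_cast ha1
    have hb0 : (0:ℝ) ≤ b := by positivity
    constructor
    · rw [div_le_iff₀ (by linarith)]
      nlinarith
    · have : (1:ℝ) ≤ ((n:ℝ) - 1) ^ 2 := by nlinarith
      nlinarith

end ThompsonPaper
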